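/- Fix 1 ≤ m ≤ n and embed U_m in U_n as {u ∈ U_n : u_{ij} ≠ 0 for i ≠ j implies i < j ≤ m}. Then for every F_q-labeled set partition μ of {1,2,…,m}, Ind_{U_m}^{U_n}(χ^μ) = χ^μ *_1 χ^{{m+1}} *_1 χ^{{m+2}} *_1 ⋯ *_1 χ^{{n}}, the products taken left to right. -/

import Mathlib

/-!
STATEMENT 17: Fix 1 ≤ m ≤ n and embed U_m in U_n as
{u ∈ U_n : u_{ij} ≠ 0, i ≠ j ⟹ i < j ≤ m}.  Then for every F_q-labeled set
partition μ of {1,…,m},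
Ind_{U_m}^{U_n}(χ^μ) = χ^μ *_1 χ^{{m+1}} *_1 χ^{{m+2}} *_1 ⋯ *_1 χ^{{n}},
the products taken left to right.
-/
open scoped Classical

noncomputable section

def setFinset {α : Type*} [Fintype α] (S : Set α) : Finset α :=
  Finset.univ.filter (· ∈ S)

/-- A strict partial order on `{1,…,n}` that is a subrelation of the usual order. -/
def IsPatternOrder {n : ℕ} (P : Fin n → Fin n → Prop) : Prop :=
  (∀ i j, P i j → i < j) ∧ ∀ i j k, P i j → P j k → P i k

/-- The pattern group `U_P` of unipotent upper-triangular matrices supported on `P`. -/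
def patternGroup (F : Type*) [Field F] {n : ℕ} (P : Fin n → Fin n → Prop) :
    Set (Matrix (Fin n) (Fin n) F) :=
  {u | (∀ i, u i i = 1) ∧ ∀ i j, i ≠ j → u i j ≠ 0 → P i j}

/-- `χ` is constant on the superclasses of `G`: `u ~ v` iff `v − 1 ∈ G(u−1)G`. -/
def IsSuperclassFn {A : Type*} [Ring A] (G : Set A) (χ : A → ℂ) : Prop :=
  ∀ u ∈ G, ∀ v ∈ G, (∃ x ∈ G, ∃ y ∈ G, v - 1 = x * (u - 1) * y) → χ u = χ v

/-- Superinduction `SInd_H^G(χ)(g) = (1/(|G||H|)) Σ_{x,y∈G} χ̇(x(g−1)y + 1)`. -/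
def SInd {A : Type*} [Ring A] [Fintype A] (G H : Set A) (χ : A → ℂ) (g : A) : ℂ :=
  (((setFinset G).card : ℂ) * ((setFinset H).card : ℂ))⁻¹ *
    ∑ x ∈ setFinset G, ∑ y ∈ setFinset G,
      if x * (g - 1) * y + 1 ∈ H then χ (x * (g - 1) * y + 1) else 0

/-- Induction `Ind_H^G(χ)(g) = (1/|H|) Σ_{y∈G} χ̇(y⁻¹ g y)`. -/
def Ind {A : Type*} [Ring A] [Fintype A] (G H : Set A) (χ : A → ℂ) (g : A) : ℂ :=
  ((setFinset H).card : ℂ)⁻¹ *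
    ∑ y ∈ setFinset G,
      if Ring.inverse y * g * y ∈ H then χ (Ring.inverse y * g * y) else 0

open Matrix

/-- The pairing `⟪a,b⟫ = Σ_{ij} a_{ij} b_{ij}`, identifying a matrix `a` with the
linear functional `b ↦ ⟪a,b⟫`. -/
def pairF {F : Type*} [Field F] {n : ℕ} (a b : Matrix (Fin n) (Fin n) F) : F :=
  ∑ i, ∑ j, a i j * b i j

/-- Projection of a matrix onto the entries supported on `P` (the matrix model of
restricting a functional to `n_P`). -/
def dproj {F : Type*} [Field F] {n : ℕ} (P : Fin n → Fin n → Prop)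
    (m : Matrix (Fin n) (Fin n) F) : Matrix (Fin n) (Fin n) F :=
  Matrix.of fun i j => if P i j then m i j else 0

/-- The left action `u·λ`, via `(uλ)(x−1) = λ(u⁻¹(x−1))`, in the matrix model:
`uλ = proj_P((u⁻¹)ᵀ λ)`. -/
def lact {F : Type*} [Field F] {n : ℕ} (P : Fin n → Fin n → Prop)
    (u lam : Matrix (Fin n) (Fin n) F) : Matrix (Fin n) (Fin n) F :=
  dproj P ((Ring.inverse u)ᵀ * lam)

/-- The right action `λ·v`, via `(λv)(x−1) = λ((x−1)v⁻¹)`:  `λv = proj_P(λ (v⁻¹)ᵀ)`. -/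
def ract {F : Type*} [Field F] {n : ℕ} (P : Fin n → Fin n → Prop)
    (lam v : Matrix (Fin n) (Fin n) F) : Matrix (Fin n) (Fin n) F :=
  dproj P (lam * (Ring.inverse v)ᵀ)

/-- The two-sided action `u·λ·v = proj_P((u⁻¹)ᵀ λ (v⁻¹)ᵀ)`. -/
def biact {F : Type*} [Field F] {n : ℕ} (P : Fin n → Fin n → Prop)
    (u lam v : Matrix (Fin n) (Fin n) F) : Matrix (Fin n) (Fin n) F :=
  dproj P ((Ring.inverse u)ᵀ * lam * (Ring.inverse v)ᵀ)

/-- The left orbit `U_P·λ`. -/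
def leftOrbit (F : Type*) [Field F] {n : ℕ} (P : Fin n → Fin n → Prop)
    (lam : Matrix (Fin n) (Fin n) F) : Set (Matrix (Fin n) (Fin n) F) :=
  {m | ∃ u ∈ patternGroup F P, m = lact P u lam}

/-- The right orbit `λ·U_P`. -/
def rightOrbit (F : Type*) [Field F] {n : ℕ} (P : Fin n → Fin n → Prop)
    (lam : Matrix (Fin n) (Fin n) F) : Set (Matrix (Fin n) (Fin n) F) :=
  {m | ∃ v ∈ patternGroup F P, m = ract P lam v}

/-- The two-sided orbit `U_P·λ·U_P`. -/
def biOrbit (F : Type*) [Field F] {n : ℕ} (P : Fin n → Fin n → Prop)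
    (lam : Matrix (Fin n) (Fin n) F) : Set (Matrix (Fin n) (Fin n) F) :=
  {m | ∃ u ∈ patternGroup F P, ∃ v ∈ patternGroup F P, m = biact P u lam v}

/-- The supercharacter
`χ^λ(u) = (|U_P λ|/|U_P λ U_P|) Σ_{μ ∈ U_P(−λ)U_P} θ(μ(u−1))`. -/
def superchar {F : Type*} [Field F] [Fintype F] {n : ℕ} (P : Fin n → Fin n → Prop)
    (θ : F → ℂ) (lam : Matrix (Fin n) (Fin n) F) (u : Matrix (Fin n) (Fin n) F) : ℂ :=
  (((setFinset (leftOrbit F P lam)).card : ℂ) / ((setFinset (biOrbit F P lam)).card : ℂ)) *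
    ∑ ν ∈ setFinset (biOrbit F P (-lam)), θ (pairF ν (u - 1))

/-- ℕ-indexed (1-based) matrix model of an F_q-labeled set partition:
`mu i j = t ≠ 0` encodes an arc `i ⌢_t j`. -/
abbrev SPF (F : Type*) := ℕ → ℕ → F

/-- Replace the `(i,k)` entry of `mu` by `t` (adjoin/delete/relabel an arc). -/
def updArc {F : Type*} (mu : SPF F) (i k : ℕ) (t : F) : SPF F :=
  fun a b => if a = i ∧ b = k then t else mu a b

/-- The combinatorial product `μ *_i {k}`, a formal ℕ-linear (here ℂ-linear)
combination of labeled set partitions, defined by the recursion of the paper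
(cases read in order). -/
noncomputable def lstar {F : Type*} [Field F] [Fintype F] (i k : ℕ) (mu : SPF F) :
    SPF F →₀ ℂ :=
  if h0 : k ≤ i then (if i = k then Finsupp.single mu 1 else 0)
  else if h2 : ∃ l, k < l ∧ mu i l ≠ 0 then (Fintype.card F) • lstar (i + 1) k mu
  else if h3 : mu i k ≠ 0 then lstar (i + 1) k (updArc mu i k 0)
  else if h4 : ∃ j, j < k ∧ mu i j ≠ 0 then
    lstar (i + 1) k mu +
      ∑ t ∈ Finset.univ.filter (fun t : F => t ≠ 0),
        lstar (i + 1) (Classical.choose h4)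
          (updArc (updArc mu i (Classical.choose h4) 0) i k t)
  else
    lstar (i + 1) k mu +
      ∑ t ∈ Finset.univ.filter (fun t : F => t ≠ 0), Finsupp.single (updArc mu i k t) 1
termination_by k - i
decreasing_by
  · omega
  · omega
  · omega
  · have := (Classical.choose_spec h4).1; omega
  · omega

/-- Convert the 1-based ℕ-indexed model to an `n × n` matrix (entry `(i,j)`, 0-based,
is `mu (i+1) (j+1)`). -/
def toMat (F : Type*) [Field F] (n : ℕ) (mu : SPF F) : Matrix (Fin n) (Fin n) F :=
  Matrix.of fun i j => mu ((i : ℕ) + 1) ((j : ℕ) + 1)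

/-- Extend `λ ↦ χ^λ` linearly: the class function `Σ_λ c_λ χ^λ` attached to a formal
combination `c` of labeled set partitions, the supercharacters taken for pattern `P`. -/
noncomputable def charOfComb {F : Type*} [Field F] [Fintype F] {n : ℕ}
    (P : Fin n → Fin n → Prop) (θ : F → ℂ) (c : SPF F →₀ ℂ)
    (g : Matrix (Fin n) (Fin n) F) : ℂ :=
  c.sum fun lam coeff => coeff * superchar P θ (toMat F n lam) g

/-- Linear extension of the product `(-) *_1 {k}` to formal combinations. -/
noncomputable def lstarExt {F : Type*} [Field F] [Fintype F]
    (c : SPF F →₀ ℂ) (k : ℕ) : SPF F →₀ ℂ :=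
  c.sum fun lam coeff => coeff • lstar 1 k lam

/-- The iterated product `μ *_1 {m+1} *_1 {m+2} *_1 ⋯ *_1 {n}`, taken left to right. -/
noncomputable def lstarIter {F : Type*} [Field F] [Fintype F]
    (mu : SPF F) (m n : ℕ) : SPF F →₀ ℂ :=
  (List.range' (m + 1) (n - m)).foldl lstarExt (Finsupp.single mu 1)

section PatternGroup

variable {F : Type*} [Field F] {n : ℕ} {P : Fin n → Fin n → Prop}

lemma mem_setFinset {α : Type*} [Fintype α] {S : Set α} {a : α} : a ∈ setFinset S ↔ a ∈ S := by
  simp [setFinset]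

/-- The nilpotent algebra of matrices supported on `P`. -/
def patternAlgebra (F : Type*) [Field F] {n : ℕ} (P : Fin n → Fin n → Prop) :
    Submodule F (Matrix (Fin n) (Fin n) F) where
  carrier := {z | ∀ i j, ¬ P i j → z i j = 0}
  add_mem' := fun ha hb i j h => by simp [ha i j h, hb i j h]
  zero_mem' := fun _ _ _ => rfl
  smul_mem' := fun c z hz i j h => by simp [hz i j h]

lemma mem_patternAlgebra {z : Matrix (Fin n) (Fin n) F} :
    z ∈ patternAlgebra F P ↔ ∀ i j, ¬ P i j → z i j = 0 := Iff.rfl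

lemma mem_patternGroup_iff (hP : IsPatternOrder P) {u : Matrix (Fin n) (Fin n) F} :
    u ∈ patternGroup F P ↔ u - 1 ∈ patternAlgebra F P := by
  rw [mem_patternAlgebra]
  constructor
  · rintro ⟨h1, h2⟩ i j hij
    by_cases h : i = j
    · subst h; simp [h1]
    · have : u i j = 0 := by
        by_contra h0
        exact hij (h2 i j h h0)
      simp [this, Matrix.one_apply_ne h]
  · intro h
    refine ⟨fun i => ?_, fun i j hij hu => ?_⟩
    · have := h i i (fun hi => lt_irrefl _ (hP.1 _ _ hi))
      simpa [sub_eq_zero] using this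
    · by_contra hp
      have := h i j hp
      simp [Matrix.one_apply_ne hij] at this
      exact hu this

lemma patternAlgebra_mul_mem (hP : IsPatternOrder P) {y z : Matrix (Fin n) (Fin n) F}
    (hy : y ∈ patternAlgebra F P) (hz : z ∈ patternAlgebra F P) :
    y * z ∈ patternAlgebra F P := by
  intro i j hij
  rw [Matrix.mul_apply]
  refine Finset.sum_eq_zero fun k _ => ?_
  by_cases h : P i k
  · rw [hz k j (fun h' => hij (hP.2 _ _ _ h h')), mul_zero]
  · rw [hy i k h, zero_mul]

lemma one_mem_patternGroup (hP : IsPatternOrder P) :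
    (1 : Matrix (Fin n) (Fin n) F) ∈ patternGroup F P := by
  rw [mem_patternGroup_iff hP]; simp

lemma patternGroup_mul_mem (hP : IsPatternOrder P) {x y : Matrix (Fin n) (Fin n) F}
    (hx : x ∈ patternGroup F P) (hy : y ∈ patternGroup F P) : x * y ∈ patternGroup F P := by
  rw [mem_patternGroup_iff hP] at *
  have : x * y - 1 = (x - 1) * (y - 1) + (x - 1) + (y - 1) := by noncomm_ring
  rw [this]
  exact add_mem (add_mem (patternAlgebra_mul_mem hP hx hy) hx) hy

lemma mul_patternAlgebra_mem (hP : IsPatternOrder P) {x z : Matrix (Fin n) (Fin n) F}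
    (hx : x ∈ patternGroup F P) (hz : z ∈ patternAlgebra F P) : x * z ∈ patternAlgebra F P := by
  rw [mem_patternGroup_iff hP] at hx
  have : x * z = (x - 1) * z + z := by noncomm_ring
  rw [this]
  exact add_mem (patternAlgebra_mul_mem hP hx hz) hz

lemma patternAlgebra_mul_group_mem (hP : IsPatternOrder P) {x z : Matrix (Fin n) (Fin n) F}
    (hx : x ∈ patternGroup F P) (hz : z ∈ patternAlgebra F P) : z * x ∈ patternAlgebra F P := by
  rw [mem_patternGroup_iff hP] at hx
  have : z * x = z * (x - 1) + z := by noncomm_ring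
  rw [this]
  exact add_mem (patternAlgebra_mul_mem hP hz hx) hz

lemma det_eq_one_of_mem_patternGroup (hP : IsPatternOrder P) {u : Matrix (Fin n) (Fin n) F}
    (hu : u ∈ patternGroup F P) : u.det = 1 := by
  rw [Matrix.det_of_isUpperTriangular]
  · simp [hu.1]
  · intro i j hij
    by_contra h0
    exact absurd (hP.1 _ _ (hu.2 i j (ne_of_gt hij) h0)) (not_lt_of_gt hij)

lemma isUnit_det_of_mem_patternGroup (hP : IsPatternOrder P) {u : Matrix (Fin n) (Fin n) F}
    (hu : u ∈ patternGroup F P) : IsUnit u.det := by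
  rw [det_eq_one_of_mem_patternGroup hP hu]; exact isUnit_one

variable [Fintype F]

lemma patternGroup_inv_mem (hP : IsPatternOrder P) {u : Matrix (Fin n) (Fin n) F}
    (hu : u ∈ patternGroup F P) : u⁻¹ ∈ patternGroup F P := by
  have hd := isUnit_det_of_mem_patternGroup hP hu
  let f : patternGroup F P → patternGroup F P := fun x => ⟨u * x, patternGroup_mul_mem hP hu x.2⟩
  have hf : Function.Injective f := by
    intro x y hxy
    have h : u * (x : Matrix (Fin n) (Fin n) F) = u * y := congrArg Subtype.val hxy
    have h2 := congrArg (u⁻¹ * ·) h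
    simp only [Matrix.nonsing_inv_mul_cancel_left _ _ hd] at h2
    exact Subtype.ext h2
  obtain ⟨v, hv⟩ := Finite.injective_iff_surjective.mp hf ⟨1, one_mem_patternGroup hP⟩
  rw [Matrix.inv_eq_right_inv (congrArg Subtype.val hv)]
  exact v.2

lemma sum_patternGroup (hP : IsPatternOrder P) (f : Matrix (Fin n) (Fin n) F → ℂ) :
    ∑ y ∈ setFinset (patternGroup F P), f y =
      ∑ z ∈ Finset.univ.filter (· ∈ patternAlgebra F P), f (1 + z) := by
  refine Finset.sum_bij' (fun y _ => y - 1) (fun z _ => 1 + z) ?_ ?_ ?_ ?_ ?_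
  · intro y hy
    simpa [mem_setFinset, mem_patternGroup_iff hP] using hy
  · intro z hz
    simpa [mem_setFinset, mem_patternGroup_iff hP] using hz
  · intros; simp
  · intros; simp
  · intros; simp

lemma sum_patternGroup_mul_right (hP : IsPatternOrder P) {h : Matrix (Fin n) (Fin n) F}
    (hh : h ∈ patternGroup F P) (f : Matrix (Fin n) (Fin n) F → ℂ) :
    ∑ y ∈ setFinset (patternGroup F P), f (y * h) = ∑ y ∈ setFinset (patternGroup F P), f y := by
  have hd := isUnit_det_of_mem_patternGroup hP hh
  refine Finset.sum_bij' (fun y _ => y * h) (fun y _ => y * h⁻¹) ?_ ?_ ?_ ?_ ?_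
  · intro y hy
    exact mem_setFinset.2 (patternGroup_mul_mem hP (mem_setFinset.1 hy) hh)
  · intro y hy
    exact mem_setFinset.2
      (patternGroup_mul_mem hP (mem_setFinset.1 hy) (patternGroup_inv_mem hP hh))
  · intros; simp [Matrix.mul_nonsing_inv_cancel_right _ _ hd]
  · intros; simp [Matrix.nonsing_inv_mul_cancel_right _ _ hd]
  · intros; rfl

lemma sum_patternGroup_mul_left (hP : IsPatternOrder P) {h : Matrix (Fin n) (Fin n) F}
    (hh : h ∈ patternGroup F P) (f : Matrix (Fin n) (Fin n) F → ℂ) :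
    ∑ y ∈ setFinset (patternGroup F P), f (h * y) = ∑ y ∈ setFinset (patternGroup F P), f y := by
  have hd := isUnit_det_of_mem_patternGroup hP hh
  refine Finset.sum_bij' (fun y _ => h * y) (fun y _ => h⁻¹ * y) ?_ ?_ ?_ ?_ ?_
  · intro y hy
    exact mem_setFinset.2 (patternGroup_mul_mem hP hh (mem_setFinset.1 hy))
  · intro y hy
    exact mem_setFinset.2
      (patternGroup_mul_mem hP (patternGroup_inv_mem hP hh) (mem_setFinset.1 hy))
  · intros; simp [Matrix.nonsing_inv_mul_cancel_left _ _ hd]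
  · intros; simp [Matrix.mul_nonsing_inv_cancel_left _ _ hd]
  · intros; rfl

lemma card_patternGroup_pos (hP : IsPatternOrder P) :
    0 < (setFinset (patternGroup F P)).card :=
  Finset.card_pos.2 ⟨1, mem_setFinset.2 (one_mem_patternGroup hP)⟩

lemma card_patternGroup_ne_zero (hP : IsPatternOrder P) :
    ((setFinset (patternGroup F P)).card : ℂ) ≠ 0 :=
  Nat.cast_ne_zero.2 (card_patternGroup_pos hP).ne'

end PatternGroup

section Fourier

variable {F : Type*} [Field F] {θ : F → ℂ}

lemma theta_zero (hθadd : ∀ a b, θ (a + b) = θ a * θ b) (hθne : ∀ a, θ a ≠ 0) : θ 0 = 1 := by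
  have h := hθadd 0 0
  rw [add_zero] at h
  exact (mul_eq_left₀ (hθne 0)).1 h.symm

lemma theta_sum (hθadd : ∀ a b, θ (a + b) = θ a * θ b) (hθne : ∀ a, θ a ≠ 0)
    {ι : Type*} (s : Finset ι) (f : ι → F) : θ (∑ i ∈ s, f i) = ∏ i ∈ s, θ (f i) := by
  induction s using Finset.induction_on with
  | empty => simp [theta_zero hθadd hθne]
  | insert a s ha ih => rw [Finset.sum_insert ha, Finset.prod_insert ha, hθadd, ih]

lemma sum_theta_linear_eq_card (hθadd : ∀ a b, θ (a + b) = θ a * θ b) (hθne : ∀ a, θ a ≠ 0)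
    {M : Type*} [AddCommGroup M] [Module F M] [Fintype M]
    (K : Submodule F M) (L : M →ₗ[F] F) (h : ∀ z ∈ K, L z = 0) :
    ∑ z ∈ Finset.univ.filter (· ∈ K), θ (L z) = ((Finset.univ.filter (· ∈ K)).card : ℂ) := by
  rw [Finset.sum_congr rfl (g := fun _ => (1 : ℂ))]
  · simp
  · intro z hz
    rw [h z (by simpa using hz), theta_zero hθadd hθne]

lemma sum_theta_linear_eq_zero (hθadd : ∀ a b, θ (a + b) = θ a * θ b)
    (hθnt : ∃ a, θ a ≠ 1) {M : Type*} [AddCommGroup M] [Module F M] [Fintype M]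
    (K : Submodule F M) (L : M →ₗ[F] F) (h : ¬ ∀ z ∈ K, L z = 0) :
    ∑ z ∈ Finset.univ.filter (· ∈ K), θ (L z) = 0 := by
  push Not at h
  obtain ⟨z₀, hz₀, hL⟩ := h
  obtain ⟨a, ha⟩ := hθnt
  set z₁ := (a / L z₀) • z₀ with hz₁
  have hz₁K : z₁ ∈ K := K.smul_mem _ hz₀
  have hL₁ : L z₁ = a := by simp [hz₁, hL]
  have key : ∑ z ∈ Finset.univ.filter (· ∈ K), θ (L z) =
      θ a * ∑ z ∈ Finset.univ.filter (· ∈ K), θ (L z) := by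
    rw [Finset.mul_sum]
    refine Finset.sum_bij' (fun z _ => z - z₁) (fun z _ => z + z₁) ?_ ?_ ?_ ?_ ?_
    · intro z hz
      simpa using K.sub_mem (by simpa using hz) hz₁K
    · intro z hz
      simpa using K.add_mem (by simpa using hz) hz₁K
    · intros; simp
    · intros; simp
    · intro z _
      rw [← hθadd, map_sub, hL₁]; congr 1; ring
  by_contra h0
  exact ha ((mul_eq_right₀ h0).1 key.symm)

end Fourier

section Orbits

lemma card_mul_sum_image {α X : Type*} [DecidableEq X] (S : Finset α) (π : α → X)
    (he : ∀ s ∈ S, ∀ a ∈ S, ∃ e : α → α, (∀ b ∈ S, e b ∈ S) ∧ Set.InjOn e S ∧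
      ∀ b ∈ S, π b = π s → π (e b) = π a) (φ : X → ℂ) :
    (S.card : ℂ) * ∑ x ∈ S.image π, φ x = ((S.image π).card : ℂ) * ∑ s ∈ S, φ (π s) := by
  rcases S.eq_empty_or_nonempty with rfl | ⟨s₀, hs₀⟩
  · simp
  have hle : ∀ s ∈ S, ∀ a ∈ S,
      (S.filter (fun b => π b = π s)).card ≤ (S.filter (fun b => π b = π a)).card := by
    intro s hs a ha
    obtain ⟨e, h1, h2, h3⟩ := he s hs a ha
    refine Finset.card_le_card_of_injOn e ?_ ?_
    · intro b hb
      obtain ⟨hb1, hb2⟩ := Finset.mem_filter.1 hb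
      exact Finset.mem_coe.2 (Finset.mem_filter.2 ⟨h1 b hb1, h3 b hb1 hb2⟩)
    · exact h2.mono (fun b hb => (Finset.mem_filter.1 hb).1)
  have hc : ∀ x ∈ S.image π,
      (S.filter (fun b => π b = x)).card = (S.filter (fun b => π b = π s₀)).card := by
    intro x hx
    obtain ⟨s, hs, rfl⟩ := Finset.mem_image.1 hx
    exact le_antisymm (hle _ hs _ hs₀) (hle _ hs₀ _ hs)
  have h1 : S.card = (S.image π).card * (S.filter (fun b => π b = π s₀)).card := by
    rw [Finset.card_eq_sum_card_image π S, Finset.sum_congr rfl hc, Finset.sum_const, smul_eq_mul]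
  have h2 : ∑ s ∈ S, φ (π s) =
      ((S.filter (fun b => π b = π s₀)).card : ℂ) * ∑ x ∈ S.image π, φ x := by
    rw [Finset.sum_comp φ π, Finset.mul_sum]
    refine Finset.sum_congr rfl fun x hx => ?_
    rw [hc x hx, nsmul_eq_mul]
  rw [h2, h1]; push_cast; ring

variable {F : Type*} [Field F] {n : ℕ} {P : Fin n → Fin n → Prop}

lemma pairF_eq_trace (a b : Matrix (Fin n) (Fin n) F) : pairF a b = (aᵀ * b).trace := by
  simp only [pairF, Matrix.trace, Matrix.diag, Matrix.mul_apply, Matrix.transpose_apply]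
  exact Finset.sum_comm

lemma pairF_dproj {w : Matrix (Fin n) (Fin n) F} (hw : w ∈ patternAlgebra F P)
    (a : Matrix (Fin n) (Fin n) F) : pairF (dproj P a) w = pairF a w := by
  refine Finset.sum_congr rfl fun i _ => Finset.sum_congr rfl fun j _ => ?_
  by_cases h : P i j
  · simp [dproj, h]
  · simp [hw i j h]

lemma pairF_mul (x y lam w : Matrix (Fin n) (Fin n) F) :
    pairF (xᵀ * lam * yᵀ) w = pairF lam (x * w * y) := by
  rw [pairF_eq_trace, pairF_eq_trace]
  simp only [Matrix.transpose_mul, Matrix.transpose_transpose]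
  rw [Matrix.mul_assoc, Matrix.trace_mul_comm]
  simp only [Matrix.mul_assoc]

lemma dproj_mul_dproj (hP : IsPatternOrder P) {x y : Matrix (Fin n) (Fin n) F}
    (hx : x ∈ patternGroup F P) (hy : y ∈ patternGroup F P) (lam : Matrix (Fin n) (Fin n) F) :
    dproj P (xᵀ * dproj P lam * yᵀ) = dproj P (xᵀ * lam * yᵀ) := by
  ext i j
  by_cases hij : P i j
  swap
  · simp [dproj, hij]
  have hs : Matrix.single i j (1 : F) ∈ patternAlgebra F P := by
    intro a b hab
    rw [Matrix.single_apply_of_ne]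
    rintro ⟨rfl, rfl⟩
    exact hab hij
  have hpair : ∀ a : Matrix (Fin n) (Fin n) F, pairF a (Matrix.single i j 1) = a i j := by
    intro a
    simp [pairF, Matrix.single_apply, ite_and]
  rw [← hpair (dproj P (xᵀ * dproj P lam * yᵀ)), ← hpair (dproj P (xᵀ * lam * yᵀ)),
    pairF_dproj hs, pairF_dproj hs, pairF_mul, pairF_mul, pairF_dproj]
  exact patternAlgebra_mul_group_mem hP hy (mul_patternAlgebra_mem hP hx hs)

variable [Fintype F]

lemma leftOrbit_eq_image (hP : IsPatternOrder P) (lam : Matrix (Fin n) (Fin n) F) :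
    setFinset (leftOrbit F P lam) =
      (setFinset (patternGroup F P)).image (fun x => dproj P (xᵀ * lam)) := by
  ext ν
  simp only [mem_setFinset, Finset.mem_image, leftOrbit, lact, Set.mem_ofPred_eq,
    ← Matrix.nonsing_inv_eq_ringInverse]
  constructor
  · rintro ⟨u, hu, rfl⟩
    exact ⟨u⁻¹, patternGroup_inv_mem hP hu, rfl⟩
  · rintro ⟨u, hu, rfl⟩
    refine ⟨u⁻¹, patternGroup_inv_mem hP hu, ?_⟩
    rw [Matrix.nonsing_inv_nonsing_inv _ (isUnit_det_of_mem_patternGroup hP hu)]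

lemma biOrbit_eq_image (hP : IsPatternOrder P) (lam : Matrix (Fin n) (Fin n) F) :
    setFinset (biOrbit F P lam) =
      (setFinset (patternGroup F P) ×ˢ setFinset (patternGroup F P)).image
        (fun p => dproj P (p.1ᵀ * lam * p.2ᵀ)) := by
  ext ν
  simp only [mem_setFinset, Finset.mem_image, biOrbit, biact, Set.mem_ofPred_eq,
    ← Matrix.nonsing_inv_eq_ringInverse, Finset.mem_product, Prod.exists]
  constructor
  · rintro ⟨u, hu, v, hv, rfl⟩
    exact ⟨u⁻¹, v⁻¹, ⟨patternGroup_inv_mem hP hu, patternGroup_inv_mem hP hv⟩, rfl⟩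
  · rintro ⟨u, v, ⟨hu, hv⟩, rfl⟩
    refine ⟨u⁻¹, patternGroup_inv_mem hP hu, v⁻¹, patternGroup_inv_mem hP hv, ?_⟩
    rw [Matrix.nonsing_inv_nonsing_inv _ (isUnit_det_of_mem_patternGroup hP hu),
      Matrix.nonsing_inv_nonsing_inv _ (isUnit_det_of_mem_patternGroup hP hv)]

lemma sum_biOrbit (hP : IsPatternOrder P) (lam : Matrix (Fin n) (Fin n) F)
    (φ : Matrix (Fin n) (Fin n) F → ℂ) :
    ((setFinset (patternGroup F P)).card : ℂ) ^ 2 * ∑ ν ∈ setFinset (biOrbit F P lam), φ ν =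
      ((setFinset (biOrbit F P lam)).card : ℂ) *
        ∑ x ∈ setFinset (patternGroup F P), ∑ y ∈ setFinset (patternGroup F P),
          φ (dproj P (xᵀ * lam * yᵀ)) := by
  have h := card_mul_sum_image (setFinset (patternGroup F P) ×ˢ setFinset (patternGroup F P))
    (fun p => dproj P (p.1ᵀ * lam * p.2ᵀ)) ?_ φ
  · rw [← biOrbit_eq_image hP, Finset.sum_product, Finset.card_product] at h
    rw [← h]; push_cast; ring
  · rintro ⟨s₁, s₂⟩ hs ⟨a₁, a₂⟩ ha
    simp only [Finset.mem_product, mem_setFinset] at hs ha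
    have hg := patternGroup_mul_mem hP (patternGroup_inv_mem hP hs.1) ha.1
    have hh := patternGroup_mul_mem hP ha.2 (patternGroup_inv_mem hP hs.2)
    have d1 := isUnit_det_of_mem_patternGroup hP hs.1
    have d2 := isUnit_det_of_mem_patternGroup hP hs.2
    have e1 := isUnit_det_of_mem_patternGroup hP hg
    have e2 := isUnit_det_of_mem_patternGroup hP hh
    have htr : ∀ b : Matrix (Fin n) (Fin n) F × Matrix (Fin n) (Fin n) F,
        dproj P ((b.1 * (s₁⁻¹ * a₁))ᵀ * lam * (a₂ * s₂⁻¹ * b.2)ᵀ) =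
        dproj P ((s₁⁻¹ * a₁)ᵀ * dproj P (b.1ᵀ * lam * b.2ᵀ) * (a₂ * s₂⁻¹)ᵀ) := by
      intro b
      rw [dproj_mul_dproj hP hg hh]
      simp only [Matrix.transpose_mul, Matrix.mul_assoc]
    refine ⟨fun b => (b.1 * (s₁⁻¹ * a₁), a₂ * s₂⁻¹ * b.2), ?_, ?_, ?_⟩
    · rintro ⟨b₁, b₂⟩ hb
      simp only [Finset.mem_product, mem_setFinset] at hb ⊢
      exact ⟨patternGroup_mul_mem hP hb.1 hg, patternGroup_mul_mem hP hh hb.2⟩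
    · rintro ⟨b₁, b₂⟩ - ⟨c₁, c₂⟩ - hbc
      simp only [Prod.mk.injEq] at hbc ⊢
      constructor
      · have := congrArg (· * (s₁⁻¹ * a₁)⁻¹) hbc.1
        simpa only [Matrix.mul_nonsing_inv_cancel_right _ _ e1] using this
      · have := congrArg ((a₂ * s₂⁻¹)⁻¹ * ·) hbc.2
        simpa only [Matrix.nonsing_inv_mul_cancel_left _ _ e2] using this
    · rintro b - hb
      dsimp only at hb ⊢
      rw [htr, hb, ← htr ⟨s₁, s₂⟩]
      simp only
      rw [Matrix.mul_nonsing_inv_cancel_left _ _ d1, Matrix.nonsing_inv_mul_cancel_right _ _ d2]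

lemma sum_leftOrbit (hP : IsPatternOrder P) (lam : Matrix (Fin n) (Fin n) F)
    (φ : Matrix (Fin n) (Fin n) F → ℂ) :
    ((setFinset (patternGroup F P)).card : ℂ) * ∑ ν ∈ setFinset (leftOrbit F P lam), φ ν =
      ((setFinset (leftOrbit F P lam)).card : ℂ) *
        ∑ x ∈ setFinset (patternGroup F P), φ (dproj P (xᵀ * lam)) := by
  rw [leftOrbit_eq_image hP]
  refine card_mul_sum_image (setFinset (patternGroup F P)) (fun x => dproj P (xᵀ * lam)) ?_ φ
  intro s hs a ha
  simp only [mem_setFinset] at hs ha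
  have hg := patternGroup_mul_mem hP (patternGroup_inv_mem hP hs) ha
  have d := isUnit_det_of_mem_patternGroup hP hs
  have e := isUnit_det_of_mem_patternGroup hP hg
  have htr : ∀ b : Matrix (Fin n) (Fin n) F,
      dproj P ((b * (s⁻¹ * a))ᵀ * lam) = dproj P ((s⁻¹ * a)ᵀ * dproj P (bᵀ * lam)) := by
    intro b
    have := dproj_mul_dproj hP hg (one_mem_patternGroup hP) (bᵀ * lam)
    simp only [Matrix.transpose_one, Matrix.mul_one] at this
    rw [this]
    simp only [Matrix.transpose_mul, Matrix.mul_assoc]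
  refine ⟨fun b => b * (s⁻¹ * a), ?_, ?_, ?_⟩
  · intro b hb
    exact mem_setFinset.2 (patternGroup_mul_mem hP (mem_setFinset.1 hb) hg)
  · intro b _ c _ hbc
    have := congrArg (· * (s⁻¹ * a)⁻¹) hbc
    simpa only [Matrix.mul_nonsing_inv_cancel_right _ _ e] using this
  · intro b _ hb
    dsimp only at hb ⊢
    rw [htr, hb, ← htr, Matrix.mul_nonsing_inv_cancel_left _ _ d]

omit [Fintype F] in
lemma dproj_neg (a : Matrix (Fin n) (Fin n) F) : dproj P (-a) = -dproj P a := by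
  ext i j
  by_cases h : P i j <;> simp [dproj, h]

lemma card_leftOrbit_neg (hP : IsPatternOrder P) (lam : Matrix (Fin n) (Fin n) F) :
    (setFinset (leftOrbit F P (-lam))).card = (setFinset (leftOrbit F P lam)).card := by
  have : setFinset (leftOrbit F P (-lam)) =
      (setFinset (leftOrbit F P lam)).image (fun x => -x) := by
    rw [leftOrbit_eq_image hP, leftOrbit_eq_image hP, Finset.image_image]
    refine Finset.image_congr fun x _ => ?_
    simp [dproj_neg]
  rw [this, Finset.card_image_of_injective _ neg_injective]

lemma card_biOrbit_neg (hP : IsPatternOrder P) (lam : Matrix (Fin n) (Fin n) F) :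
    (setFinset (biOrbit F P (-lam))).card = (setFinset (biOrbit F P lam)).card := by
  have : setFinset (biOrbit F P (-lam)) = (setFinset (biOrbit F P lam)).image (fun x => -x) := by
    rw [biOrbit_eq_image hP, biOrbit_eq_image hP, Finset.image_image]
    refine Finset.image_congr fun x _ => ?_
    simp [dproj_neg]
  rw [this, Finset.card_image_of_injective _ neg_injective]

end Orbits

section Superchar

variable {F : Type*} [Field F] [Fintype F] {n : ℕ} {P : Fin n → Fin n → Prop} {θ : F → ℂ}

lemma superchar_eq_average (hP : IsPatternOrder P) (lam : Matrix (Fin n) (Fin n) F)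
    {u : Matrix (Fin n) (Fin n) F} (hu : u ∈ patternGroup F P) :
    superchar P θ lam u =
      ((setFinset (leftOrbit F P (-lam))).card : ℂ) /
        ((setFinset (patternGroup F P)).card : ℂ) ^ 2 *
        ∑ x ∈ setFinset (patternGroup F P), ∑ y ∈ setFinset (patternGroup F P),
          θ (pairF (-lam) (x * (u - 1) * y)) := by
  have hw := (mem_patternGroup_iff hP).1 hu
  have hU : ((setFinset (patternGroup F P)).card : ℂ) ≠ 0 := card_patternGroup_ne_zero hP
  have hB : ((setFinset (biOrbit F P (-lam))).card : ℂ) ≠ 0 := by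
    refine Nat.cast_ne_zero.2 (Finset.card_pos.2 ?_).ne'
    rw [biOrbit_eq_image hP]
    have h1 := mem_setFinset.2 (one_mem_patternGroup (F := F) hP)
    exact ⟨_, Finset.mem_image_of_mem _ (Finset.mk_mem_product h1 h1)⟩
  have h := sum_biOrbit hP (-lam) (fun ν => θ (pairF ν (u - 1)))
  simp only [pairF_dproj hw, pairF_mul] at h
  rw [superchar, ← card_leftOrbit_neg hP, ← card_biOrbit_neg hP]
  generalize (∑ ν ∈ setFinset (biOrbit F P (-lam)), θ (pairF ν (u - 1))) = A at h ⊢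
  have hA : A = ((setFinset (biOrbit F P (-lam))).card : ℂ) *
      (∑ x ∈ setFinset (patternGroup F P), ∑ y ∈ setFinset (patternGroup F P),
          θ (pairF (-lam) (x * (u - 1) * y))) / ((setFinset (patternGroup F P)).card : ℂ) ^ 2 := by
    rw [← h]; field_simp
  rw [hA]; field_simp

lemma superchar_conj (hP : IsPatternOrder P) (lam : Matrix (Fin n) (Fin n) F)
    {u y : Matrix (Fin n) (Fin n) F} (hu : u ∈ patternGroup F P) (hy : y ∈ patternGroup F P) :
    superchar P θ lam (y⁻¹ * u * y) = superchar P θ lam u := by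
  have hy' := patternGroup_inv_mem hP hy
  have hd := isUnit_det_of_mem_patternGroup hP hy
  have hc : y⁻¹ * u * y - 1 = y⁻¹ * (u - 1) * y := by
    rw [Matrix.mul_sub, Matrix.sub_mul, Matrix.mul_one, Matrix.nonsing_inv_mul _ hd]
  have hmul : ∀ x z : Matrix (Fin n) (Fin n) F,
      x * y * (y⁻¹ * (u - 1) * y) * (y⁻¹ * z) = x * (u - 1) * z := by
    intro x z
    simp only [Matrix.mul_assoc]
    rw [Matrix.mul_nonsing_inv_cancel_left _ _ hd, Matrix.mul_nonsing_inv_cancel_left _ _ hd]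
  have h1 := sum_patternGroup_mul_right hP hy (fun x => ∑ z ∈ setFinset (patternGroup F P),
      θ (pairF (-lam) (x * (y⁻¹ * (u - 1) * y) * z)))
  have h2 : ∀ x, ∑ z ∈ setFinset (patternGroup F P), θ (pairF (-lam) (x * (u - 1) * z)) =
      ∑ z ∈ setFinset (patternGroup F P),
        θ (pairF (-lam) (x * y * (y⁻¹ * (u - 1) * y) * z)) := by
    intro x
    have h := sum_patternGroup_mul_left hP hy' (fun z =>
      θ (pairF (-lam) (x * y * (y⁻¹ * (u - 1) * y) * z)))
    simp only [hmul] at h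
    exact h
  rw [superchar_eq_average hP lam (patternGroup_mul_mem hP (patternGroup_mul_mem hP hy' hu) hy),
    superchar_eq_average hP lam hu, hc, ← h1]
  simp only [h2]

omit [Fintype F] in
/-- Pairing with a fixed matrix after left multiplication, as a linear form. -/
def pairLinear (ν w : Matrix (Fin n) (Fin n) F) : Matrix (Fin n) (Fin n) F →ₗ[F] F where
  toFun z := pairF ν (w * z)
  map_add' a b := by
    simp [pairF, mul_add, Finset.sum_add_distrib]
  map_smul' c a := by
    simp only [pairF, Matrix.mul_smul, Matrix.smul_apply, smul_eq_mul, RingHom.id_apply,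
      Finset.mul_sum]
    exact Finset.sum_congr rfl fun i _ => Finset.sum_congr rfl fun j _ => by ring

omit [Fintype F] in
lemma pairLinear_apply (ν w z : Matrix (Fin n) (Fin n) F) :
    pairLinear ν w z = pairF ν (w * z) := rfl

lemma superchar_eq_sum_fixed (hθadd : ∀ a b, θ (a + b) = θ a * θ b) (hθne : ∀ a, θ a ≠ 0)
    (hθnt : ∃ a, θ a ≠ 1) (hP : IsPatternOrder P) (lam : Matrix (Fin n) (Fin n) F)
    {u : Matrix (Fin n) (Fin n) F} (hu : u ∈ patternGroup F P) :
    superchar P θ lam u = ∑ ν ∈ setFinset (leftOrbit F P (-lam)),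
      if ∀ z ∈ patternAlgebra F P, pairF ν ((u - 1) * z) = 0 then θ (pairF ν (u - 1)) else 0 := by
  have hw := (mem_patternGroup_iff hP).1 hu
  have hU : ((setFinset (patternGroup F P)).card : ℂ) ≠ 0 := card_patternGroup_ne_zero hP
  have hcard : ((setFinset (patternGroup F P)).card : ℂ) =
      ((Finset.univ.filter (· ∈ patternAlgebra F P)).card : ℂ) := by
    simpa using sum_patternGroup (F := F) hP (fun _ => 1)
  have hy : ∀ ν : Matrix (Fin n) (Fin n) F,
      ∑ y ∈ setFinset (patternGroup F P), θ (pairF ν ((u - 1) * y)) =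
      ((setFinset (patternGroup F P)).card : ℂ) *
      if ∀ z ∈ patternAlgebra F P, pairF ν ((u - 1) * z) = 0 then θ (pairF ν (u - 1)) else 0 := by
    intro ν
    rw [sum_patternGroup hP]
    have h1 : ∀ z, θ (pairF ν ((u - 1) * (1 + z))) =
        θ (pairF ν (u - 1)) * θ (pairLinear ν (u - 1) z) := by
      intro z
      rw [← hθadd]
      congr 1
      have := (pairLinear ν (u - 1)).map_add 1 z
      rwa [pairLinear_apply, pairLinear_apply, Matrix.mul_one] at this
    simp only [h1]
    rw [← Finset.mul_sum, hcard]
    by_cases h : ∀ z ∈ patternAlgebra F P, pairF ν ((u - 1) * z) = 0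
    · rw [if_pos h, sum_theta_linear_eq_card hθadd hθne _ _ h, mul_comm]
    · rw [if_neg h, sum_theta_linear_eq_zero hθadd hθnt _ _ h, mul_zero, mul_zero]
  have hx : ∀ y ∈ setFinset (patternGroup F P),
      ((setFinset (leftOrbit F P (-lam))).card : ℂ) *
      ∑ x ∈ setFinset (patternGroup F P), θ (pairF (-lam) (x * (u - 1) * y)) =
      ((setFinset (patternGroup F P)).card : ℂ) *
        ∑ ν ∈ setFinset (leftOrbit F P (-lam)), θ (pairF ν ((u - 1) * y)) := by
    intro y hy
    rw [sum_leftOrbit hP (-lam) (fun ν => θ (pairF ν ((u - 1) * y)))]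
    congr 1
    refine Finset.sum_congr rfl fun x _ => ?_
    rw [pairF_dproj (patternAlgebra_mul_group_mem hP (mem_setFinset.1 hy) hw)]
    have := pairF_mul x 1 (-lam) ((u - 1) * y)
    simp only [Matrix.transpose_one, Matrix.mul_one] at this
    rw [this, Matrix.mul_assoc]
  rw [superchar_eq_average hP lam hu, Finset.sum_comm, div_mul_eq_mul_div, Finset.mul_sum,
    Finset.sum_congr rfl hx, ← Finset.mul_sum, Finset.sum_comm,
    Finset.sum_congr rfl (fun ν _ => hy ν),
    ← Finset.mul_sum]
  field_simp

end Superchar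

section ArcSums

variable {F : Type*} [Field F] [Fintype F] {n : ℕ}

/-- The vectors killed on the columns before `b` by right multiplication by `w`. -/
def FixedBefore (w : Matrix (Fin n) (Fin n) F) (b : Fin n) (c : Fin n → F) : Prop :=
  ∀ s, s < b → (c ᵥ* w) s = 0

/-- The possible columns of an element of the left orbit of a single arc `a ⌢_t b`. -/
def colSet (a b : Fin n) (t : F) : Finset (Fin n → F) :=
  Finset.univ.filter fun c => (∀ r, r < a → c r = 0) ∧ c a = t ∧ ∀ r, b ≤ r → c r = 0

/-- The value at `1 + w` of the supercharacter of a single arc `a ⌢_{-t} b` (for `t ≠ 0`). -/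
def arcSum (θ : F → ℂ) (w : Matrix (Fin n) (Fin n) F) (a b : Fin n) (t : F) : ℂ :=
  ∑ c ∈ (colSet a b t).filter (FixedBefore w b), θ ((c ᵥ* w) b)

/-- The function multiplying `χ^μ` in the product `μ *_i {b + 1}`. -/
def tailSum (θ : F → ℂ) (w : Matrix (Fin n) (Fin n) F) (i : ℕ) (b : Fin n) : ℂ :=
  ∑ c ∈ Finset.univ.filter (fun c : Fin n → F =>
    (∀ r : Fin n, (r : ℕ) + 1 < i → c r = 0) ∧ (∀ r, b ≤ r → c r = 0) ∧ FixedBefore w b c),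
    θ ((c ᵥ* w) b)

/-- The possible `b`-th columns of an element of the left orbit of a matrix with `b`-th
column `v`. -/
def colOrbit (v : Fin n → F) (b : Fin n) : Finset (Fin n → F) :=
  Finset.univ.filter fun c => (∀ a, v a ≠ 0 → c ∈ colSet a b (v a)) ∧ ((∀ a, v a = 0) → c = 0)

/-- The contribution of the `b`-th column to a supercharacter. -/
def colFactor (θ : F → ℂ) (w : Matrix (Fin n) (Fin n) F) (v : Fin n → F) (b : Fin n) : ℂ :=
  ∑ c ∈ (colOrbit v b).filter (FixedBefore w b), θ ((c ᵥ* w) b)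

/-- The product formula for the value of `χ^λ` at `1 + w`. -/
def arcProd (θ : F → ℂ) (w lam : Matrix (Fin n) (Fin n) F) : ℂ :=
  ∏ b, colFactor θ w (fun a => -lam a b) b

variable {θ : F → ℂ} {w : Matrix (Fin n) (Fin n) F}

omit [Fintype F] in
lemma fixedBefore_zero (w : Matrix (Fin n) (Fin n) F) (b : Fin n) : FixedBefore w b 0 := by
  intro s _; simp

lemma tailSum_self (hθ : θ 0 = 1) (b : Fin n) : tailSum θ w ((b : ℕ) + 1) b = 1 := by
  have : Finset.univ.filter (fun c : Fin n → F =>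
      (∀ r : Fin n, (r : ℕ) + 1 < (b : ℕ) + 1 → c r = 0) ∧
      (∀ r, b ≤ r → c r = 0) ∧ FixedBefore w b c) = {0} := by
    ext c
    simp only [Finset.mem_filter, Finset.mem_univ, true_and, Finset.mem_singleton]
    constructor
    · rintro ⟨h1, h2, -⟩
      funext r
      by_cases h : b ≤ r
      · exact h2 r h
      · exact h1 r (by have := not_le.1 h; simpa using this)
    · rintro rfl
      exact ⟨fun _ _ => rfl, fun _ _ => rfl, fixedBefore_zero w b⟩
  rw [tailSum, this]
  simp [hθ]

lemma tailSum_eq_sum (a b : Fin n) : tailSum θ w ((a : ℕ) + 1) b = ∑ t, arcSum θ w a b t := by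
  rw [tailSum, ← Finset.sum_fiberwise (g := fun c : Fin n → F => c a)]
  refine Finset.sum_congr rfl fun t _ => ?_
  rw [arcSum]
  refine Finset.sum_congr ?_ fun _ _ => rfl
  ext c
  simp only [Finset.mem_filter, Finset.mem_univ, true_and, colSet, add_lt_add_iff_right,
    Fin.val_fin_lt]
  tauto

lemma arcSum_zero (a b : Fin n) : arcSum θ w a b 0 = tailSum θ w ((a : ℕ) + 2) b := by
  rw [tailSum, arcSum]
  refine Finset.sum_congr ?_ fun _ _ => rfl
  ext c
  simp only [Finset.mem_filter, Finset.mem_univ, true_and, colSet]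
  constructor
  · rintro ⟨⟨h1, h2, h3⟩, h4⟩
    refine ⟨fun r hr => ?_, h3, h4⟩
    rcases lt_or_eq_of_le (show r ≤ a by rw [Fin.le_def]; omega) with h | rfl
    · exact h1 r h
    · exact h2
  · rintro ⟨h1, h2, h3⟩
    refine ⟨⟨fun r hr => h1 r ?_, h1 a (by omega), h2⟩, h3⟩
    rw [Fin.lt_def] at hr; omega

lemma arcSum_eq_arcSum_zero (hw : ∀ r s, ¬ r < s → w r s = 0) {a b d : Fin n}
    (hab : a < b) (hbd : b < d) {s : F} (hs : s ≠ 0) (h : arcSum θ w a d s ≠ 0) (t : F) :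
    arcSum θ w a b t = arcSum θ w a b 0 := by
  obtain ⟨c, hc, -⟩ := Finset.exists_ne_zero_of_sum_ne_zero h
  simp only [Finset.mem_filter, Finset.mem_univ, true_and, colSet] at hc
  obtain ⟨⟨hc1, hc2, -⟩, hc4⟩ := hc
  set c' : Fin n → F := fun r => if r < b then t / s * c r else 0 with hc'
  have hkill : ∀ x, x ≤ b → (c' ᵥ* w) x = 0 := by
    intro x hx
    have : (c' ᵥ* w) x = t / s * (c ᵥ* w) x := by
      simp only [Matrix.vecMul, dotProduct, Finset.mul_sum]
      refine Finset.sum_congr rfl fun r _ => ?_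
      by_cases hr : r < b
      · simp [hc', hr, mul_assoc]
      · rw [hw r x (fun h => hr (lt_of_lt_of_le h hx))]; simp
    rw [this, hc4 x (lt_of_le_of_lt hx hbd), mul_zero]
  have hc'a : c' a = t := by simp [hc', hab, hc2, hs]
  have hc'lt : ∀ r, r < a → c' r = 0 := fun r hr => by simp [hc', hc1 r hr]
  have hc'ge : ∀ r, b ≤ r → c' r = 0 := fun r hr => by simp [hc', not_lt.2 hr]
  rw [arcSum, arcSum]
  refine Finset.sum_bij' (fun v _ => v - c') (fun v _ => v + c') ?_ ?_ ?_ ?_ ?_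
  · intro v hv
    simp only [Finset.mem_filter, Finset.mem_univ, true_and, colSet] at hv ⊢
    obtain ⟨⟨h1, h2, h3⟩, h4⟩ := hv
    refine ⟨⟨fun r hr => ?_, ?_, fun r hr => ?_⟩, fun x hx => ?_⟩
    · simp [h1 r hr, hc'lt r hr]
    · simp [h2, hc'a]
    · simp [h3 r hr, hc'ge r hr]
    · simp [Matrix.sub_vecMul, h4 x hx, hkill x hx.le]
  · intro v hv
    simp only [Finset.mem_filter, Finset.mem_univ, true_and, colSet] at hv ⊢
    obtain ⟨⟨h1, h2, h3⟩, h4⟩ := hv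
    refine ⟨⟨fun r hr => ?_, ?_, fun r hr => ?_⟩, fun x hx => ?_⟩
    · simp [h1 r hr, hc'lt r hr]
    · simp [h2, hc'a]
    · simp [h3 r hr, hc'ge r hr]
    · simp [Matrix.add_vecMul, h4 x hx, hkill x hx.le]
  · intros; simp
  · intros; simp
  · intro v _
    simp [Matrix.sub_vecMul, hkill b le_rfl]

lemma colFactor_of_eq_zero (hθ : θ 0 = 1) {v : Fin n → F} (hv : ∀ a, v a = 0) (b : Fin n) :
    colFactor θ w v b = 1 := by
  have : (colOrbit v b).filter (FixedBefore w b) = {0} := by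
    ext c
    simp only [colOrbit, Finset.mem_filter, Finset.mem_univ, true_and, Finset.mem_singleton]
    constructor
    · exact fun h => h.1.2 hv
    · rintro rfl
      exact ⟨⟨fun a ha => absurd (hv a) ha, fun _ => rfl⟩, fixedBefore_zero w b⟩
  rw [colFactor, this]
  simp [hθ]

lemma colFactor_of_ne_zero {v : Fin n → F} {a : Fin n} (ha : v a ≠ 0)
    (hv : ∀ c, v c ≠ 0 → c = a) (b : Fin n) : colFactor θ w v b = arcSum θ w a b (v a) := by
  have : colOrbit v b = colSet a b (v a) := by
    ext c
    simp only [colOrbit, Finset.mem_filter, Finset.mem_univ, true_and]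
    constructor
    · exact fun h => h.1 a ha
    · refine fun h => ⟨fun d hd => ?_, fun h0 => absurd (h0 a) ha⟩
      rw [hv d hd]; exact h
  rw [colFactor, this, arcSum]

lemma arcProd_of_update (hθ : θ 0 = 1) {lam lam' : Matrix (Fin n) (Fin n) F} {a b : Fin n}
    {t : F} (ht : t ≠ 0) (hlam : ∀ c, lam c b = 0)
    (hlam' : ∀ c d, lam' c d = if c = a ∧ d = b then t else lam c d) :
    arcProd θ w lam' = arcProd θ w lam * arcSum θ w a b (-t) := by
  have hab : lam' a b = t := by simp [hlam']
  have h₁ : colFactor θ w (fun c => -lam c b) b = 1 := colFactor_of_eq_zero hθ (by simp [hlam]) b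
  have h₂ : colFactor θ w (fun c => -lam' c b) b = arcSum θ w a b (-t) := by
    rw [colFactor_of_ne_zero (a := a), hab]
    · rw [hab]; simpa using ht
    · intro c hc
      by_contra hca
      simp [hlam', hca, hlam] at hc
  rw [arcProd, arcProd, ← Finset.mul_prod_erase _ _ (Finset.mem_univ b), h₂,
    ← Finset.mul_prod_erase (a := b) Finset.univ (fun d => colFactor θ w (fun c => -lam c d) d)
      (Finset.mem_univ b), h₁, one_mul, mul_comm]
  congr 1
  refine Finset.prod_congr rfl fun d hd => ?_
  congr 1
  funext c
  simp [hlam', Finset.ne_of_mem_erase hd]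

end ArcSums

section ProductFormula

variable {F : Type*} [Field F] {n : ℕ}

/-- The pattern of the copy of `U_N` inside the `n × n` matrices. -/
def cornerOrder (n N : ℕ) (i j : Fin n) : Prop := i < j ∧ (j : ℕ) + 1 ≤ N

lemma isPatternOrder_cornerOrder (n N : ℕ) : IsPatternOrder (cornerOrder n N) :=
  ⟨fun _ _ h => h.1, fun _ _ _ h h' => ⟨h.1.trans h'.1, h'.2⟩⟩

/-- A matrix encoding a labeled set partition of `{1,…,N}`. -/
structure IsArcMatrix (N : ℕ) (lam : Matrix (Fin n) (Fin n) F) : Prop where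
  supp : ∀ a b, lam a b ≠ 0 → cornerOrder n N a b
  row : ∀ a b b', lam a b ≠ 0 → lam a b' ≠ 0 → b = b'
  col : ∀ a a' b, lam a b ≠ 0 → lam a' b ≠ 0 → a = a'

lemma IsArcMatrix.neg {N : ℕ} {lam : Matrix (Fin n) (Fin n) F} (h : IsArcMatrix N lam) :
    IsArcMatrix N (-lam) := by
  constructor
  · intro a b hab; exact h.supp a b (by simpa using hab)
  · intro a b b' h1 h2; exact h.row a b b' (by simpa using h1) (by simpa using h2)
  · intro a b b' h1 h2; exact h.col a b b' (by simpa using h1) (by simpa using h2)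

variable [Fintype F]

lemma mem_leftOrbit_iff {N : ℕ} {lam : Matrix (Fin n) (Fin n) F} (h : IsArcMatrix N lam)
    (ν : Matrix (Fin n) (Fin n) F) :
    ν ∈ setFinset (leftOrbit F (cornerOrder n N) lam) ↔
      ∀ b, (fun a => ν a b) ∈ colOrbit (fun a => lam a b) b := by
  rw [leftOrbit_eq_image (isPatternOrder_cornerOrder n N)]
  simp only [Finset.mem_image, mem_setFinset, colOrbit, colSet, Finset.mem_filter,
    Finset.mem_univ, true_and]
  have hent : ∀ (x : Matrix (Fin n) (Fin n) F) (a b c : Fin n), lam c b ≠ 0 →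
      dproj (cornerOrder n N) (xᵀ * lam) a b = if a < b then x c a * lam c b else 0 := by
    intro x a b c hc
    have hN := (h.supp c b hc).2
    simp only [dproj, Matrix.of_apply, cornerOrder, hN, and_true, Matrix.mul_apply,
      Matrix.transpose_apply]
    congr 1
    refine Finset.sum_eq_single c (fun d _ hd => ?_) (by simp)
    have : lam d b = 0 := by
      by_contra h0
      exact hd (h.col d c b h0 hc)
    rw [this, mul_zero]
  constructor
  · rintro ⟨x, hx, rfl⟩ b
    refine ⟨fun c hc => ⟨fun r hr => ?_, ?_, fun r hr => ?_⟩, fun hz => ?_⟩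
    · rw [hent x r b c hc]
      have : x c r = 0 := by
        by_contra h0
        exact absurd (hx.2 c r hr.ne' h0).1 (not_lt.2 hr.le)
      simp [this]
    · rw [hent x c b c hc, if_pos (h.supp c b hc).1, hx.1, one_mul]
    · rw [hent x r b c hc, if_neg (not_lt.2 hr)]
    · funext a
      simp [dproj, Matrix.mul_apply, hz]
  · intro hν
    set x : Matrix (Fin n) (Fin n) F := Matrix.of fun c a => if c = a then 1 else
      if c < a then ∑ b, (if lam c b ≠ 0 ∧ a < b then ν a b / lam c b else 0) else 0 with hx
    refine ⟨x, ⟨fun i => by simp [hx], fun i j hij hxij => ?_⟩, ?_⟩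
    · simp only [hx, Matrix.of_apply, if_neg hij] at hxij
      split_ifs at hxij with hlt
      · obtain ⟨b, -, hb⟩ := Finset.exists_ne_zero_of_sum_ne_zero hxij
        split_ifs at hb with hb'
        · refine ⟨hlt, ?_⟩
          have h1 := (h.supp i b hb'.1).2
          have h2 := hb'.2
          rw [Fin.lt_def] at h2
          omega
        · exact absurd rfl hb
      · exact absurd rfl hxij
    · ext a b
      obtain ⟨h1, h2⟩ := hν b
      by_cases hz : ∀ c, lam c b = 0
      · have := congrFun (h2 hz) a
        simp only [Pi.zero_apply] at this
        rw [this]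
        simp [dproj, Matrix.mul_apply, hz]
      · push Not at hz
        obtain ⟨c, hc⟩ := hz
        obtain ⟨h3, h4, h5⟩ := h1 c hc
        rw [hent x a b c hc]
        split_ifs with hab
        · rcases lt_trichotomy a c with hac | rfl | hac
          · rw [h3 a hac]
            simp [hx, hac.ne', not_lt.2 hac.le]
          · rw [h4]; simp [hx]
          · simp only [hx, Matrix.of_apply, if_neg hac.ne, if_pos hac]
            rw [Finset.sum_eq_single b]
            · rw [if_pos ⟨hc, hab⟩, div_mul_cancel₀ _ hc]
            · intro b' _ hb'
              rw [if_neg]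
              rintro ⟨h6, -⟩
              exact hb' (h.row c b' b h6 hc)
            · simp
        · exact (h5 a (not_lt.1 hab)).symm

omit [Fintype F] in
lemma pairF_eq_sum_vecMul (ν w : Matrix (Fin n) (Fin n) F) :
    pairF ν w = ∑ b, ((fun a => ν a b) ᵥ* w) b := by
  simp only [pairF, Matrix.vecMul, dotProduct]
  exact Finset.sum_comm

omit [Fintype F] in
lemma pairF_mul_eq_sum (ν w z : Matrix (Fin n) (Fin n) F) :
    pairF ν (w * z) = ∑ b, ∑ s, ((fun a => ν a b) ᵥ* w) s * z s b := by
  rw [pairF_eq_sum_vecMul]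
  refine Finset.sum_congr rfl fun b _ => ?_
  rw [← Matrix.vecMul_vecMul]
  rfl

omit [Fintype F] in
lemma pairF_mul_eq_zero_iff {N : ℕ} {ν w : Matrix (Fin n) (Fin n) F}
    (hν : ∀ b : Fin n, N < (b : ℕ) + 1 → ∀ a, ν a b = 0) :
    (∀ z ∈ patternAlgebra F (cornerOrder n N), pairF ν (w * z) = 0) ↔
      ∀ b, FixedBefore w b (fun a => ν a b) := by
  constructor
  · intro h b s hsb
    by_cases hb : (b : ℕ) + 1 ≤ N
    · have hz : Matrix.single s b (1 : F) ∈ patternAlgebra F (cornerOrder n N) := by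
        intro i j hij
        rw [Matrix.single_apply_of_ne]
        rintro ⟨rfl, rfl⟩
        exact hij ⟨hsb, hb⟩
      have := h _ hz
      rw [pairF_mul_eq_sum] at this
      simpa [Matrix.single_apply, ite_and] using this
    · have : (fun a => ν a b) = 0 := funext fun a => hν b (not_le.1 hb) a
      rw [this]; simp
  · intro h z hz
    rw [pairF_mul_eq_sum]
    refine Finset.sum_eq_zero fun b _ => Finset.sum_eq_zero fun s _ => ?_
    by_cases hsb : s < b
    · rw [h b s hsb, zero_mul]
    · rw [hz s b (fun h => hsb h.1), mul_zero]

variable {θ : F → ℂ}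

lemma superchar_eq_arcProd (hθadd : ∀ a b, θ (a + b) = θ a * θ b) (hθne : ∀ a, θ a ≠ 0)
    (hθnt : ∃ a, θ a ≠ 1) {N : ℕ} {lam : Matrix (Fin n) (Fin n) F} (h : IsArcMatrix N lam)
    {u : Matrix (Fin n) (Fin n) F} (hu : u ∈ patternGroup F (cornerOrder n N)) :
    superchar (cornerOrder n N) θ lam u = arcProd θ (u - 1) lam := by
  rw [superchar_eq_sum_fixed hθadd hθne hθnt (isPatternOrder_cornerOrder n N) lam hu, arcProd]
  simp only [colFactor]
  rw [Finset.prod_univ_sum, ← Finset.sum_filter]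
  refine Finset.sum_bij' (fun ν _ => νᵀ) (fun p _ => (p : Matrix (Fin n) (Fin n) F)ᵀ) ?_ ?_ ?_ ?_ ?_
  · intro ν hν
    obtain ⟨hν1, hν2⟩ := Finset.mem_filter.1 hν
    rw [mem_leftOrbit_iff h.neg] at hν1
    rw [pairF_mul_eq_zero_iff] at hν2
    · refine Fintype.mem_piFinset.2 fun b => Finset.mem_filter.2 ⟨hν1 b, hν2 b⟩
    · intro b hb a
      have := (Finset.mem_filter.1 (hν1 b)).2.2 (fun c => by
        by_contra h0
        exact absurd (h.neg.supp c b h0).2 (not_le.2 hb))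
      exact congrFun this a
  · intro p hp
    have hp1 := fun b => (Finset.mem_filter.1 (Fintype.mem_piFinset.1 hp b)).1
    have hp2 := fun b => (Finset.mem_filter.1 (Fintype.mem_piFinset.1 hp b)).2
    refine Finset.mem_filter.2 ⟨(mem_leftOrbit_iff h.neg _).2 hp1, ?_⟩
    rw [pairF_mul_eq_zero_iff]
    · exact hp2
    · intro b hb a
      have := (Finset.mem_filter.1 (hp1 b)).2.2 (fun c => by
        by_contra h0
        exact absurd (h.neg.supp c b h0).2 (not_le.2 hb))
      exact congrFun this a
  · intros; rfl
  · intros; rfl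
  · intro ν _
    rw [pairF_eq_sum_vecMul, theta_sum hθadd hθne]
    rfl

end ProductFormula

section StarProduct

variable {F : Type*} [Field F] {n : ℕ}

/-- `mu` encodes a labeled set partition of `{1,…,N}`. -/
structure IsArcSet (N : ℕ) (mu : SPF F) : Prop where
  supp : ∀ i j, mu i j ≠ 0 → 1 ≤ i ∧ i < j ∧ j ≤ N
  row : ∀ i j j', mu i j ≠ 0 → mu i j' ≠ 0 → j = j'
  col : ∀ i i' j, mu i j ≠ 0 → mu i' j ≠ 0 → i = i'

lemma IsArcSet.isArcMatrix_toMat {N : ℕ} {mu : SPF F} (h : IsArcSet N mu) :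
    IsArcMatrix N (toMat F n mu) := by
  constructor
  · intro a b hab
    obtain ⟨-, h2, h3⟩ := h.supp _ _ hab
    exact ⟨by rw [Fin.lt_def]; omega, h3⟩
  · intro a b b' h1 h2
    have := h.row _ _ _ h1 h2
    exact Fin.ext (by omega)
  · intro a a' b h1 h2
    have := h.col _ _ _ h1 h2
    exact Fin.ext (by omega)

lemma IsArcSet.updArc_zero {N : ℕ} {mu : SPF F} (h : IsArcSet N mu) (i k : ℕ) :
    IsArcSet N (updArc mu i k 0) := by
  have key : ∀ a b, updArc mu i k 0 a b ≠ 0 → mu a b ≠ 0 := by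
    intro a b hab
    rw [updArc] at hab
    split_ifs at hab with h'
    · exact absurd rfl hab
    · exact hab
  exact ⟨fun a b hab => h.supp a b (key a b hab),
    fun a b b' h1 h2 => h.row a b b' (key _ _ h1) (key _ _ h2),
    fun a a' b h1 h2 => h.col a a' b (key _ _ h1) (key _ _ h2)⟩

lemma IsArcSet.updArc {N : ℕ} {mu : SPF F} (h : IsArcSet N mu) {i k : ℕ} (hi : 1 ≤ i)
    (hik : i < k) (hkN : k ≤ N) (hrow : ∀ j, mu i j = 0) (hcol : ∀ j, mu j k = 0) (t : F) :
    IsArcSet N (updArc mu i k t) := by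
  have key : ∀ a b, _root_.updArc mu i k t a b ≠ 0 →
      (a = i ∧ b = k) ∨ (a ≠ i ∧ b ≠ k ∧ mu a b ≠ 0) := by
    intro a b hab
    rw [_root_.updArc] at hab
    split_ifs at hab with h'
    · exact Or.inl h'
    · refine Or.inr ⟨?_, ?_, hab⟩
      · rintro rfl; exact hab (hrow b)
      · rintro rfl; exact hab (hcol a)
  refine ⟨fun a b hab => ?_, fun a b b' h1 h2 => ?_, fun a a' b h1 h2 => ?_⟩
  · rcases key a b hab with ⟨rfl, rfl⟩ | ⟨-, -, h'⟩
    · exact ⟨hi, hik, hkN⟩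
    · exact h.supp a b h'
  · rcases key _ _ h1 with h1 | h1 <;> rcases key _ _ h2 with h2 | h2
    · rw [h1.2, h2.2]
    · exact absurd h1.1 h2.1
    · exact absurd h2.1 h1.1
    · exact h.row a b b' h1.2.2 h2.2.2
  · rcases key _ _ h1 with h1 | h1 <;> rcases key _ _ h2 with h2 | h2
    · rw [h1.1, h2.1]
    · exact absurd h1.2 h2.2.1
    · exact absurd h2.2 h1.2.1
    · exact h.col a a' b h1.2.2 h2.2.2

lemma toMat_updArc (mu : SPF F) (a b : Fin n) (t : F) (c d : Fin n) :
    toMat F n (updArc mu ((a : ℕ) + 1) ((b : ℕ) + 1) t) c d =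
      if c = a ∧ d = b then t else toMat F n mu c d := by
  simp [toMat, updArc, Fin.ext_iff]

variable [Fintype F] {θ : F → ℂ} {w : Matrix (Fin n) (Fin n) F}

/-- The value at `1 + w` of the character attached to a formal combination, computed with the
product formula. -/
def combVal (θ : F → ℂ) (w : Matrix (Fin n) (Fin n) F) : (SPF F →₀ ℂ) →ₗ[ℂ] ℂ :=
  Finsupp.linearCombination ℂ fun lam => arcProd θ w (toMat F n lam)

lemma combVal_single (lam : SPF F) :
    combVal θ w (Finsupp.single lam 1) = arcProd θ w (toMat F n lam) := by
  simp [combVal]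

lemma arcProd_updArc (hθ : θ 0 = 1) {mu : SPF F} {a b : Fin n} {t : F} (ht : t ≠ 0)
    (hcol : ∀ j, mu j ((b : ℕ) + 1) = 0) :
    arcProd θ w (toMat F n (updArc mu ((a : ℕ) + 1) ((b : ℕ) + 1) t)) =
      arcProd θ w (toMat F n mu) * arcSum θ w a b (-t) :=
  arcProd_of_update hθ ht (fun _ => hcol _) (toMat_updArc mu a b t)

lemma arcProd_eq_updArc_zero_mul (hθ : θ 0 = 1) {N : ℕ} {mu : SPF F} (h : IsArcSet N mu)
    {a b : Fin n} (hab : mu ((a : ℕ) + 1) ((b : ℕ) + 1) ≠ 0) :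
    arcProd θ w (toMat F n mu) =
      arcProd θ w (toMat F n (updArc mu ((a : ℕ) + 1) ((b : ℕ) + 1) 0)) *
        arcSum θ w a b (-mu ((a : ℕ) + 1) ((b : ℕ) + 1)) := by
  refine arcProd_of_update hθ hab (fun c => ?_) (fun c d => ?_)
  · rw [toMat_updArc]
    split_ifs with hc
    · rfl
    · by_contra h0
      have := h.col _ _ _ h0 hab
      exact hc ⟨Fin.ext (by omega), rfl⟩
  · rw [toMat_updArc]
    split_ifs with hc
    · rw [hc.1, hc.2]; rfl
    · rfl

lemma tailSum_eq_add (a b : Fin n) :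
    tailSum θ w ((a : ℕ) + 1) b = tailSum θ w ((a : ℕ) + 2) b +
      ∑ t ∈ Finset.univ.filter (fun t : F => t ≠ 0), arcSum θ w a b (-t) := by
  rw [tailSum_eq_sum, ← arcSum_zero,
    ← Equiv.sum_comp (Equiv.neg F) (fun t => arcSum θ w a b t), Finset.filter_ne',
    ← Finset.add_sum_erase _ _ (Finset.mem_univ (0 : F))]
  simp

lemma tailSum_eq_card_mul (hw : ∀ r s, ¬ r < s → w r s = 0) {a b d : Fin n}
    (hab : a < b) (hbd : b < d) {s : F} (hs : s ≠ 0) (h : arcSum θ w a d s ≠ 0) :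
    tailSum θ w ((a : ℕ) + 1) b = (Fintype.card F : ℂ) * tailSum θ w ((a : ℕ) + 2) b := by
  rw [tailSum_eq_sum, ← arcSum_zero,
    Finset.sum_congr rfl fun t _ => arcSum_eq_arcSum_zero hw hab hbd hs h t]
  simp

lemma lstar_spec (hθ : θ 0 = 1) (hw : ∀ r s, ¬ r < s → w r s = 0) {N : ℕ} (hN : N ≤ n) (d : ℕ) :
    ∀ (i : ℕ) (b : Fin n) (mu : SPF F), IsArcSet N mu → 1 ≤ i → i ≤ (b : ℕ) + 1 →
      (b : ℕ) + 1 ≤ i + d → (b : ℕ) + 1 ≤ N → (∀ j, mu j ((b : ℕ) + 1) = 0) →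
      lstar i ((b : ℕ) + 1) mu ∈ Finsupp.supported ℂ ℂ {lam | IsArcSet N lam} ∧
      combVal θ w (lstar i ((b : ℕ) + 1) mu) =
        arcProd θ w (toMat F n mu) * tailSum θ w i b := by
  induction d with
  | zero =>
    intro i b mu hmu _ hib hbi _ _
    obtain rfl : i = (b : ℕ) + 1 := by omega
    rw [lstar, dif_pos le_rfl, if_pos rfl, combVal_single, tailSum_self hθ, mul_one]
    exact ⟨Finsupp.single_mem_supported ℂ _ hmu, rfl⟩
  | succ d ih =>
    intro i b mu hmu hi hib hbi hbN hcol
    by_cases h0 : (b : ℕ) + 1 ≤ i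
    · exact ih i b mu hmu hi hib (by omega) hbN hcol
    obtain ⟨a, rfl⟩ : ∃ a : Fin n, i = (a : ℕ) + 1 := ⟨⟨i - 1, by omega⟩, by simp; omega⟩
    have hab : a < b := by rw [Fin.lt_def]; omega
    obtain ⟨ih1, ih2⟩ := ih ((a : ℕ) + 1 + 1) b mu hmu (by omega) (by omega) (by omega) hbN hcol
    rw [lstar, dif_neg h0]
    by_cases h2 : ∃ l, (b : ℕ) + 1 < l ∧ mu ((a : ℕ) + 1) l ≠ 0
    · rw [dif_pos h2]
      refine ⟨Submodule.smul_of_tower_mem _ _ ih1, ?_⟩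
      rw [map_nsmul, ih2, nsmul_eq_mul]
      obtain ⟨l, hl, hml⟩ := h2
      have hlN := (hmu.supp _ _ hml).2.2
      obtain ⟨e, rfl⟩ : ∃ e : Fin n, l = (e : ℕ) + 1 := ⟨⟨l - 1, by omega⟩, by simp; omega⟩
      rw [arcProd_eq_updArc_zero_mul hθ hmu hml]
      by_cases hz : arcSum θ w a e (-mu ((a : ℕ) + 1) ((e : ℕ) + 1)) = 0
      · simp [hz]
      · rw [tailSum_eq_card_mul hw hab (by rw [Fin.lt_def]; omega) (neg_ne_zero.2 hml) hz]
        ring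
    rw [dif_neg h2, dif_neg (not_not.2 (hcol _))]
    by_cases h4 : ∃ j, j < (b : ℕ) + 1 ∧ mu ((a : ℕ) + 1) j ≠ 0
    · rw [dif_pos h4]
      obtain ⟨hjb, hmj⟩ := Classical.choose_spec h4
      generalize Classical.choose h4 = j at hjb hmj ⊢
      have hsj := hmu.supp _ _ hmj
      obtain ⟨e, rfl⟩ : ∃ e : Fin n, j = (e : ℕ) + 1 := ⟨⟨j - 1, by omega⟩, by simp; omega⟩
      have hae : a < e := by rw [Fin.lt_def]; omega
      have heb : e < b := by rw [Fin.lt_def]; omega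
      have hnu := hmu.updArc_zero ((a : ℕ) + 1) ((e : ℕ) + 1)
      have hnurow : ∀ j, updArc mu ((a : ℕ) + 1) ((e : ℕ) + 1) 0 ((a : ℕ) + 1) j = 0 := by
        intro j
        by_contra hne
        simp only [updArc, true_and] at hne
        split_ifs at hne with hje
        · exact hne rfl
        · exact hje (hmu.row _ _ _ hne hmj)
      have hnucol : ∀ j, updArc mu ((a : ℕ) + 1) ((e : ℕ) + 1) 0 j ((b : ℕ) + 1) = 0 := by
        intro j
        simp [updArc, hcol]
      have hnucole : ∀ j, updArc mu ((a : ℕ) + 1) ((e : ℕ) + 1) 0 j ((e : ℕ) + 1) = 0 := by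
        intro j
        by_contra hne
        simp only [updArc, and_true] at hne
        split_ifs at hne with hja
        · exact hne rfl
        · exact hja (hmu.col _ _ _ hne hmj)
      have ih' : ∀ t : F, _ := fun t => ih ((a : ℕ) + 1 + 1) e
        (updArc (updArc mu ((a : ℕ) + 1) ((e : ℕ) + 1) 0) ((a : ℕ) + 1) ((b : ℕ) + 1) t)
        (hnu.updArc (by omega) (by omega) hbN hnurow hnucol t) (by omega) (by omega) (by omega)
        (by omega) (by
          intro j
          rw [updArc, if_neg (by omega)]
          exact hnucole j)
      refine ⟨Submodule.add_mem _ ih1 (Submodule.sum_mem _ fun t _ => (ih' t).1), ?_⟩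
      rw [map_add, map_sum, ih2, tailSum_eq_add, mul_add, Finset.mul_sum]
      congr 1
      refine Finset.sum_congr rfl fun t ht => ?_
      have ht0 : t ≠ 0 := (Finset.mem_filter.1 ht).2
      rw [(ih' t).2, arcProd_updArc hθ ht0 hnucol, arcProd_eq_updArc_zero_mul hθ hmu hmj]
      by_cases hz : arcSum θ w a b (-t) = 0
      · simp [hz]
      · rw [arcSum_eq_arcSum_zero hw hae heb (neg_ne_zero.2 ht0) hz, arcSum_zero]
        ring
    · rw [dif_neg h4]
      have hrow : ∀ j, mu ((a : ℕ) + 1) j = 0 := by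
        intro j
        by_contra hne
        rcases lt_trichotomy j ((b : ℕ) + 1) with hj | rfl | hj
        · exact h4 ⟨j, hj, hne⟩
        · exact hne (hcol _)
        · exact h2 ⟨j, hj, hne⟩
      refine ⟨Submodule.add_mem _ ih1 (Submodule.sum_mem _ fun t _ =>
        Finsupp.single_mem_supported ℂ _
          (hmu.updArc (by omega) (by omega) hbN hrow hcol t)), ?_⟩
      rw [map_add, map_sum, ih2, tailSum_eq_add, mul_add, Finset.mul_sum]
      congr 1
      refine Finset.sum_congr rfl fun t ht => ?_
      rw [combVal_single, arcProd_updArc hθ (Finset.mem_filter.1 ht).2 hcol]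

end StarProduct

section Induction

lemma Ind_congr {A : Type*} [Ring A] [Fintype A] {G H : Set A} {χ χ' : A → ℂ}
    (h : ∀ x ∈ H, χ x = χ' x) (g : A) : Ind G H χ g = Ind G H χ' g := by
  rw [Ind, Ind]
  congr 1
  refine Finset.sum_congr rfl fun y _ => ?_
  split_ifs with hy
  · exact h _ hy
  · rfl

lemma Ind_sum {A : Type*} [Ring A] [Fintype A] {ι : Type*} (G H : Set A) (s : Finset ι)
    (c : ι → ℂ) (f : ι → A → ℂ) (g : A) :
    Ind G H (fun x => ∑ i ∈ s, c i * f i x) g = ∑ i ∈ s, c i * Ind G H (f i) g := by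
  simp only [Ind, Finset.mul_sum]
  rw [Finset.sum_comm]
  refine Finset.sum_congr rfl fun y _ => ?_
  split_ifs
  · rw [Finset.mul_sum]
    exact Finset.sum_congr rfl fun i _ => by ring
  · simp

variable {n : ℕ} {F : Type*} [Field F] [Fintype F] {P Q R : Fin n → Fin n → Prop}

lemma Ind_eq_inv (G H : Set (Matrix (Fin n) (Fin n) F)) (χ : Matrix (Fin n) (Fin n) F → ℂ)
    (g : Matrix (Fin n) (Fin n) F) :
    Ind G H χ g = ((setFinset H).card : ℂ)⁻¹ *
      ∑ y ∈ setFinset G, if y⁻¹ * g * y ∈ H then χ (y⁻¹ * g * y) else 0 := by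
  simp only [Ind, Matrix.nonsing_inv_eq_ringInverse]

lemma conj_mem_patternGroup (hP : IsPatternOrder P) {g y : Matrix (Fin n) (Fin n) F}
    (hg : g ∈ patternGroup F P) (hy : y ∈ patternGroup F P) :
    y⁻¹ * g * y ∈ patternGroup F P :=
  patternGroup_mul_mem hP (patternGroup_mul_mem hP (patternGroup_inv_mem hP hy) hg) hy

lemma conj_mem_patternGroup_iff (hP : IsPatternOrder P) {g y : Matrix (Fin n) (Fin n) F}
    (hy : y ∈ patternGroup F P) : y⁻¹ * g * y ∈ patternGroup F P ↔ g ∈ patternGroup F P := by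
  refine ⟨fun h => ?_, fun h => conj_mem_patternGroup hP h hy⟩
  have hd := isUnit_det_of_mem_patternGroup hP hy
  have := conj_mem_patternGroup hP h (patternGroup_inv_mem hP hy)
  simpa only [Matrix.nonsing_inv_nonsing_inv _ hd, Matrix.mul_assoc,
    Matrix.mul_nonsing_inv_cancel_left _ _ hd, Matrix.mul_nonsing_inv _ hd, mul_one] using this

lemma Ind_self (hP : IsPatternOrder P) {χ : Matrix (Fin n) (Fin n) F → ℂ}
    {g : Matrix (Fin n) (Fin n) F} (hg : g ∈ patternGroup F P)
    (hχ : ∀ y ∈ patternGroup F P, χ (y⁻¹ * g * y) = χ g) :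
    Ind (patternGroup F P) (patternGroup F P) χ g = χ g := by
  rw [Ind_eq_inv, Finset.sum_congr rfl (g := fun _ => χ g)]
  · rw [Finset.sum_const, nsmul_eq_mul, inv_mul_cancel_left₀ (card_patternGroup_ne_zero hP)]
  · intro y hy
    rw [mem_setFinset] at hy
    rw [if_pos (conj_mem_patternGroup hP hg hy), hχ y hy]

omit [Fintype F] in
lemma patternGroup_mono (h : ∀ i j, P i j → Q i j) : patternGroup F P ⊆ patternGroup F Q :=
  fun _ hu => ⟨hu.1, fun i j hij h0 => h i j (hu.2 i j hij h0)⟩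

lemma Ind_trans (hP : IsPatternOrder P) (hQ : IsPatternOrder Q) (hRQ : ∀ i j, R i j → Q i j)
    (hQP : ∀ i j, Q i j → P i j) (χ : Matrix (Fin n) (Fin n) F → ℂ)
    (g : Matrix (Fin n) (Fin n) F) :
    Ind (patternGroup F P) (patternGroup F Q)
      (Ind (patternGroup F Q) (patternGroup F R) χ) g =
      Ind (patternGroup F P) (patternGroup F R) χ g := by
  set φ : Matrix (Fin n) (Fin n) F → ℂ := fun y =>
    if y⁻¹ * g * y ∈ patternGroup F R then χ (y⁻¹ * g * y) else 0 with hφ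
  have hterm : ∀ y, (if y⁻¹ * g * y ∈ patternGroup F Q then
      Ind (patternGroup F Q) (patternGroup F R) χ (y⁻¹ * g * y) else 0) =
      ((setFinset (patternGroup F R)).card : ℂ)⁻¹ *
        ∑ z ∈ setFinset (patternGroup F Q), φ (y * z) := by
    intro y
    have hconj : ∀ z : Matrix (Fin n) (Fin n) F,
        (y * z)⁻¹ * g * (y * z) = z⁻¹ * (y⁻¹ * g * y) * z := by
      intro z
      simp only [Matrix.mul_inv_rev, Matrix.mul_assoc]
    simp only [hφ, hconj]
    split_ifs with h
    · rw [Ind_eq_inv]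
    · rw [Finset.sum_eq_zero, mul_zero]
      intro z hz
      rw [mem_setFinset] at hz
      rw [if_neg]
      exact fun h' => h ((conj_mem_patternGroup_iff hQ hz).1 (patternGroup_mono hRQ h'))
  rw [Ind_eq_inv, Ind_eq_inv, Finset.sum_congr rfl fun y _ => hterm y, ← Finset.mul_sum,
    Finset.sum_comm, Finset.sum_congr rfl fun z hz =>
      sum_patternGroup_mul_right hP (patternGroup_mono hQP (mem_setFinset.1 hz)) φ,
    Finset.sum_const, nsmul_eq_mul]
  rw [mul_left_comm, inv_mul_cancel_left₀ (card_patternGroup_ne_zero hQ)]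

end Induction

section OneStep

variable {n : ℕ} {F : Type*} [Field F]

/-- The column vectors vanishing from row `b` on. -/
def headSpace (F : Type*) [Field F] (b : Fin n) : Submodule F (Fin n → F) where
  carrier := {c | ∀ r, b ≤ r → c r = 0}
  add_mem' := fun ha hb r h => by simp [ha r h, hb r h]
  zero_mem' := fun _ _ => rfl
  smul_mem' := fun a c hc r h => by simp [hc r h]

lemma mem_headSpace {b : Fin n} {c : Fin n → F} :
    c ∈ headSpace F b ↔ ∀ r, b ≤ r → c r = 0 := Iff.rfl

lemma mem_patternAlgebra_cornerOrder_iff {b : Fin n} {z : Matrix (Fin n) (Fin n) F}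
    (hz : z ∈ patternAlgebra F (cornerOrder n ((b : ℕ) + 1))) :
    z ∈ patternAlgebra F (cornerOrder n b) ↔ ∀ i, z i b = 0 := by
  refine ⟨fun h i => h i b fun h' => by have := h'.2; omega, fun h i j hij => ?_⟩
  by_cases hjb : j = b
  · rw [hjb, h]
  · refine hz i j fun h' => hij ⟨h'.1, ?_⟩
    have := h'.2
    have : (j : ℕ) ≠ b := fun h => hjb (Fin.ext h)
    omega

lemma IsArcMatrix.mono {N N' : ℕ} (hN : N ≤ N') {lam : Matrix (Fin n) (Fin n) F}
    (h : IsArcMatrix N lam) : IsArcMatrix N' lam :=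
  ⟨fun a b hab => ⟨(h.supp a b hab).1, (h.supp a b hab).2.trans hN⟩, h.row, h.col⟩

variable [Fintype F]

lemma card_patternAlgebra_succ (b : Fin n) :
    (Finset.univ.filter (· ∈ patternAlgebra F (cornerOrder n ((b : ℕ) + 1)))).card =
      (Finset.univ.filter (· ∈ patternAlgebra F (cornerOrder n b))).card *
        (Finset.univ.filter (· ∈ headSpace F b)).card := by
  rw [← Finset.card_product]
  refine Finset.card_bij' (fun z _ => (z.updateCol b 0, fun r => z r b))
    (fun p _ => p.1.updateCol b p.2) ?_ ?_ ?_ ?_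
  · intro z hz
    simp only [Finset.mem_filter, Finset.mem_univ, true_and, Finset.mem_product] at hz ⊢
    refine ⟨?_, fun r hr => hz r b fun h => absurd h.1 (not_lt.2 hr)⟩
    rw [mem_patternAlgebra_cornerOrder_iff]
    · simp
    · intro i j hij
      by_cases hjb : j = b
      · simp [hjb]
      · rw [Matrix.updateCol_ne hjb, hz i j hij]
  · rintro ⟨z, c⟩ hp
    simp only [Finset.mem_filter, Finset.mem_univ, true_and, Finset.mem_product] at hp ⊢
    intro i j hij
    by_cases hjb : j = b
    · subst hjb
      rw [Matrix.updateCol_self]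
      exact hp.2 i (not_lt.1 fun h => hij ⟨h, le_rfl⟩)
    · rw [Matrix.updateCol_ne hjb]
      exact hp.1 i j fun h => hij ⟨h.1, h.2.trans (Nat.le_succ _)⟩
  · intro z _
    ext i j
    by_cases hjb : j = b
    · simp [hjb]
    · simp [Matrix.updateCol_ne hjb]
  · rintro ⟨z, c⟩ hp
    simp only [Finset.mem_filter, Finset.mem_univ, true_and, Finset.mem_product] at hp
    refine Prod.ext ?_ (funext fun r => by simp)
    ext i j
    by_cases hjb : j = b
    · subst hjb
      simp [hp.1 i j fun h' => by have := h'.2; omega]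
    · simp [Matrix.updateCol_ne hjb]

lemma card_patternGroup {P : Fin n → Fin n → Prop} (hP : IsPatternOrder P) :
    ((setFinset (patternGroup F P)).card : ℂ) =
      (Finset.univ.filter (· ∈ patternAlgebra F P)).card := by
  simpa using sum_patternGroup (F := F) hP fun _ => 1

lemma card_patternGroup_succ (b : Fin n) :
    ((setFinset (patternGroup F (cornerOrder n ((b : ℕ) + 1)))).card : ℂ) =
      (setFinset (patternGroup F (cornerOrder n b))).card *
        (Finset.univ.filter (· ∈ headSpace F b)).card := by
  rw [card_patternGroup (isPatternOrder_cornerOrder _ _),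
    card_patternGroup (isPatternOrder_cornerOrder _ _), card_patternAlgebra_succ]
  push_cast; rfl

variable {θ : F → ℂ}

lemma conj_mem_cornerGroup_iff {b : Fin n} {g y : Matrix (Fin n) (Fin n) F}
    (hg : g ∈ patternGroup F (cornerOrder n ((b : ℕ) + 1)))
    (hy : y ∈ patternGroup F (cornerOrder n ((b : ℕ) + 1))) :
    y⁻¹ * g * y ∈ patternGroup F (cornerOrder n b) ↔
      ∀ c ∈ headSpace F b, (c ᵥ* ((g - 1) * y)) b = 0 := by
  have hP := isPatternOrder_cornerOrder n ((b : ℕ) + 1)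
  have hd := isUnit_det_of_mem_patternGroup hP hy
  have hw := (mem_patternGroup_iff hP).1 hg
  have hwy := patternAlgebra_mul_group_mem hP hy hw
  have hu : y⁻¹ * g * y - 1 = y⁻¹ * ((g - 1) * y) := by
    rw [Matrix.sub_mul, Matrix.mul_sub, one_mul, Matrix.nonsing_inv_mul _ hd, Matrix.mul_assoc]
  rw [mem_patternGroup_iff (isPatternOrder_cornerOrder n b),
    mem_patternAlgebra_cornerOrder_iff
      ((mem_patternGroup_iff hP).1 (conj_mem_patternGroup hP hg hy)), hu]
  have hcol : (∀ i, (y⁻¹ * ((g - 1) * y)) i b = 0) ↔ ∀ i, ((g - 1) * y) i b = 0 := by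
    constructor
    · intro h i
      rw [← Matrix.mul_nonsing_inv_cancel_left y ((g - 1) * y) hd, Matrix.mul_apply]
      exact Finset.sum_eq_zero fun k _ => by rw [h k, mul_zero]
    · intro h i
      rw [Matrix.mul_apply]
      exact Finset.sum_eq_zero fun k _ => by rw [h k, mul_zero]
  rw [hcol]
  constructor
  · intro h c _
    rw [Matrix.vecMul, dotProduct]
    exact Finset.sum_eq_zero fun k _ => by rw [h k, mul_zero]
  · intro h i
    by_cases hib : i < b
    · have := h (Pi.single i 1) fun r hr => by simp [(hib.trans_le hr).ne']
      simpa [Matrix.single_one_vecMul] using this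
    · exact hwy i b fun h' => hib h'.1

lemma sum_theta_vecMul_mul (hθadd : ∀ a b, θ (a + b) = θ a * θ b) (hθne : ∀ a, θ a ≠ 0)
    (hθnt : ∃ a, θ a ≠ 1) {b : Fin n} (w : Matrix (Fin n) (Fin n) F) (c : Fin n → F) :
    ∑ y ∈ setFinset (patternGroup F (cornerOrder n ((b : ℕ) + 1))), θ ((c ᵥ* (w * y)) b) =
      if FixedBefore w b c then
        ((setFinset (patternGroup F (cornerOrder n ((b : ℕ) + 1)))).card : ℂ) * θ ((c ᵥ* w) b)
      else 0 := by
  have hP := isPatternOrder_cornerOrder n ((b : ℕ) + 1)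
  let L : Matrix (Fin n) (Fin n) F →ₗ[F] F :=
    { toFun := fun z => ((c ᵥ* w) ᵥ* z) b
      map_add' := fun x y => by simp [Matrix.vecMul_add]
      map_smul' := fun a x => by simp [Matrix.vecMul_smul] }
  have hsplit : ∀ z, θ ((c ᵥ* (w * (1 + z))) b) = θ ((c ᵥ* w) b) * θ (L z) := by
    intro z
    rw [← hθadd, Matrix.mul_add, mul_one, Matrix.vecMul_add, ← Matrix.vecMul_vecMul]
    rfl
  have hfix : FixedBefore w b c ↔
      ∀ z ∈ patternAlgebra F (cornerOrder n ((b : ℕ) + 1)), L z = 0 := by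
    constructor
    · intro h z hz
      change ∑ s, (c ᵥ* w) s * z s b = 0
      refine Finset.sum_eq_zero fun s _ => ?_
      by_cases hs : s < b
      · rw [h s hs, zero_mul]
      · rw [hz s b fun h' => hs h'.1, mul_zero]
    · intro h s hs
      have := h (Matrix.single s b 1) fun i j hij => by
        rw [Matrix.single_apply, if_neg]
        rintro ⟨rfl, rfl⟩
        exact hij ⟨hs, le_rfl⟩
      simpa [L, Matrix.vecMul, dotProduct, Matrix.single_apply] using this
  rw [sum_patternGroup hP, Finset.sum_congr rfl fun z _ => hsplit z, ← Finset.mul_sum,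
    card_patternGroup hP]
  split_ifs with h
  · rw [sum_theta_linear_eq_card hθadd hθne _ L (hfix.1 h), mul_comm]
  · rw [sum_theta_linear_eq_zero hθadd hθnt _ L (fun h' => h (hfix.2 h')), mul_zero]

lemma Ind_arcProd (hθadd : ∀ a b, θ (a + b) = θ a * θ b) (hθne : ∀ a, θ a ≠ 0)
    (hθnt : ∃ a, θ a ≠ 1) {b : Fin n} {lam : Matrix (Fin n) (Fin n) F}
    (hlam : IsArcMatrix b lam) {g : Matrix (Fin n) (Fin n) F}
    (hg : g ∈ patternGroup F (cornerOrder n ((b : ℕ) + 1))) :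
    Ind (patternGroup F (cornerOrder n ((b : ℕ) + 1))) (patternGroup F (cornerOrder n b))
      (fun h => arcProd θ (h - 1) lam) g = arcProd θ (g - 1) lam * tailSum θ (g - 1) 1 b := by
  have hP := isPatternOrder_cornerOrder n ((b : ℕ) + 1)
  have hlam' := hlam.mono (Nat.le_succ b)
  set V := Finset.univ.filter (· ∈ headSpace F b) with hV
  have hVcard : (V.card : ℂ) ≠ 0 :=
    Nat.cast_ne_zero.2 (Finset.card_pos.2 ⟨0, by simp [hV]⟩).ne'
  have hterm : ∀ y ∈ setFinset (patternGroup F (cornerOrder n ((b : ℕ) + 1))),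
      (if y⁻¹ * g * y ∈ patternGroup F (cornerOrder n b) then
        arcProd θ (y⁻¹ * g * y - 1) lam else 0) =
      arcProd θ (g - 1) lam * (V.card : ℂ)⁻¹ * ∑ c ∈ V, θ ((c ᵥ* ((g - 1) * y)) b) := by
    intro y hy
    rw [mem_setFinset] at hy
    have hconj : arcProd θ (y⁻¹ * g * y - 1) lam = arcProd θ (g - 1) lam := by
      rw [← superchar_eq_arcProd hθadd hθne hθnt hlam' hg,
        ← superchar_eq_arcProd hθadd hθne hθnt hlam' (conj_mem_patternGroup hP hg hy),
        superchar_conj hP lam hg hy]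
    let L : (Fin n → F) →ₗ[F] F :=
      { toFun := fun c => (c ᵥ* ((g - 1) * y)) b
        map_add' := fun x y => by simp [Matrix.add_vecMul]
        map_smul' := fun a x => by simp [Matrix.smul_vecMul] }
    rw [hconj]
    change _ = _ * ∑ c ∈ V, θ (L c)
    split_ifs with h
    · rw [sum_theta_linear_eq_card hθadd hθne (headSpace F b) L
        ((conj_mem_cornerGroup_iff hg hy).1 h), mul_assoc, inv_mul_cancel₀ hVcard, mul_one]
    · rw [sum_theta_linear_eq_zero hθadd hθnt (headSpace F b) L
        (fun h' => h ((conj_mem_cornerGroup_iff hg hy).2 h')), mul_zero]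
  rw [Ind_eq_inv, Finset.sum_congr rfl hterm, ← Finset.mul_sum, Finset.sum_comm,
    Finset.sum_congr rfl fun c _ => sum_theta_vecMul_mul hθadd hθne hθnt (g - 1) c,
    ← Finset.sum_filter, ← Finset.mul_sum, card_patternGroup_succ, ← hV]
  have htail : tailSum θ (g - 1) 1 b =
      ∑ c ∈ V.filter (FixedBefore (g - 1) b), θ ((c ᵥ* (g - 1)) b) := by
    rw [tailSum]
    refine Finset.sum_congr ?_ fun _ _ => rfl
    ext c
    simp [hV, mem_headSpace]
  rw [htail]
  have := card_patternGroup_ne_zero (F := F) (isPatternOrder_cornerOrder n b)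
  field_simp

end OneStep

section Iterate

variable {n : ℕ} {F : Type*} [Field F]

lemma IsArcSet.mono {N N' : ℕ} (hN : N ≤ N') {mu : SPF F} (h : IsArcSet N mu) :
    IsArcSet N' mu :=
  ⟨fun i j hij => ⟨(h.supp i j hij).1, (h.supp i j hij).2.1, (h.supp i j hij).2.2.trans hN⟩,
    h.row, h.col⟩

variable [Fintype F] {θ : F → ℂ}

lemma combVal_apply (w : Matrix (Fin n) (Fin n) F) (c : SPF F →₀ ℂ) :
    combVal θ w c = ∑ lam ∈ c.support, c lam * arcProd θ w (toMat F n lam) := rfl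

lemma lstarExt_spec (hθ : θ 0 = 1) {b : Fin n} {c : SPF F →₀ ℂ}
    (hc : c ∈ Finsupp.supported ℂ ℂ {lam | IsArcSet (b : ℕ) lam})
    {w : Matrix (Fin n) (Fin n) F} (hw : ∀ r s, ¬ r < s → w r s = 0) :
    lstarExt c ((b : ℕ) + 1) ∈ Finsupp.supported ℂ ℂ {lam | IsArcSet ((b : ℕ) + 1) lam} ∧
      combVal θ w (lstarExt c ((b : ℕ) + 1)) = combVal θ w c * tailSum θ w 1 b := by
  have key : ∀ lam ∈ c.support, _ := fun lam hlam =>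
    have h : IsArcSet (b : ℕ) lam := hc hlam
    lstar_spec hθ hw (N := (b : ℕ) + 1) b.2 b 1 b lam (h.mono (Nat.le_succ _)) le_rfl
      (Nat.le_add_left _ _) (by omega) le_rfl fun j => by
        by_contra h0
        have := (h.supp _ _ h0).2.2
        omega
  constructor
  · exact Submodule.sum_mem _ fun lam hlam => Submodule.smul_mem _ _ (key lam hlam).1
  · rw [lstarExt, Finsupp.sum, map_sum, combVal_apply, Finset.sum_mul]
    refine Finset.sum_congr rfl fun lam hlam => ?_
    rw [map_smul, (key lam hlam).2, smul_eq_mul, mul_assoc]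

lemma Ind_superchar_eq_combVal (hθadd : ∀ a b, θ (a + b) = θ a * θ b) (hθne : ∀ a, θ a ≠ 0)
    (hθnt : ∃ a, θ a ≠ 1) {m : ℕ} {mu : SPF F} (hmu : IsArcSet m mu) (d : ℕ) (hd : m + d ≤ n) :
    (List.range' (m + 1) d).foldl lstarExt (Finsupp.single mu 1) ∈
        Finsupp.supported ℂ ℂ {lam | IsArcSet (m + d) lam} ∧
      ∀ g ∈ patternGroup F (cornerOrder n (m + d)),
        Ind (patternGroup F (cornerOrder n (m + d))) (patternGroup F (cornerOrder n m))
          (superchar (cornerOrder n m) θ (toMat F n mu)) g =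
        combVal θ (g - 1) ((List.range' (m + 1) d).foldl lstarExt (Finsupp.single mu 1)) := by
  induction d with
  | zero =>
    refine ⟨Finsupp.single_mem_supported ℂ 1 hmu, fun g hg => ?_⟩
    have hP := isPatternOrder_cornerOrder n m
    rw [List.range'_zero, List.foldl_nil, combVal_single]
    exact (Ind_self hP hg fun y hy => superchar_conj hP _ hg hy).trans
      (superchar_eq_arcProd hθadd hθne hθnt hmu.isArcMatrix_toMat hg)
  | succ d ih =>
    obtain ⟨ihs, ihv⟩ := ih (by omega)
    set c := (List.range' (m + 1) d).foldl lstarExt (Finsupp.single mu 1)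
    obtain ⟨b, hb⟩ : ∃ b : Fin n, (b : ℕ) = m + d := ⟨⟨m + d, by omega⟩, rfl⟩
    have hstep : (List.range' (m + 1) (d + 1)).foldl lstarExt (Finsupp.single mu 1) =
        lstarExt c ((b : ℕ) + 1) := by
      rw [List.range'_1_concat, List.foldl_append, hb, Nat.add_right_comm]
      rfl
    rw [hstep, ← Nat.add_assoc, ← hb]
    rw [← hb] at ihs ihv
    have hθ := theta_zero hθadd hθne
    have hP := isPatternOrder_cornerOrder n ((b : ℕ) + 1)
    refine ⟨(lstarExt_spec hθ ihs (w := 0) fun _ _ _ => rfl).1, fun g hg => ?_⟩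
    have hw : ∀ r s, ¬ r < s → (g - 1) r s = 0 := fun r s hrs =>
      (mem_patternGroup_iff hP).1 hg r s fun h => hrs h.1
    rw [(lstarExt_spec hθ ihs hw).2,
      ← Ind_trans hP (isPatternOrder_cornerOrder n b) (fun i j h => ⟨h.1, by have := h.2; omega⟩)
        (fun i j h => ⟨h.1, h.2.trans (Nat.le_succ _)⟩), Ind_congr ihv]
    simp only [combVal_apply, Ind_sum, Finset.sum_mul]
    refine Finset.sum_congr rfl fun lam hlam => ?_
    rw [Ind_arcProd hθadd hθne hθnt (IsArcSet.isArcMatrix_toMat (ihs hlam)) hg, mul_assoc]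

lemma charOfComb_eq_combVal (hθadd : ∀ a b, θ (a + b) = θ a * θ b) (hθne : ∀ a, θ a ≠ 0)
    (hθnt : ∃ a, θ a ≠ 1) {N : ℕ} {c : SPF F →₀ ℂ}
    (hc : c ∈ Finsupp.supported ℂ ℂ {lam | IsArcSet N lam}) {g : Matrix (Fin n) (Fin n) F}
    (hg : g ∈ patternGroup F (cornerOrder n N)) :
    charOfComb (cornerOrder n N) θ c g = combVal θ (g - 1) c :=
  Finset.sum_congr rfl fun _ hlam => congrArg _
    (superchar_eq_arcProd hθadd hθne hθnt (IsArcSet.isArcMatrix_toMat (hc hlam)) hg)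

end Iterate

theorem induced_supercharacter_eq_iterated_star_product
    {n m : ℕ} (hm : 1 ≤ m) (hmn : m ≤ n) (F : Type*) [Field F] [Fintype F]
    (θ : F → ℂ) (hθadd : ∀ a b, θ (a + b) = θ a * θ b)
    (hθne : ∀ a, θ a ≠ 0) (hθnt : ∃ a, θ a ≠ 1)
    (mu : SPF F)
    (hsupp : ∀ i j, mu i j ≠ 0 → 1 ≤ i ∧ i < j ∧ j ≤ m)
    (hrow : ∀ i j j', mu i j ≠ 0 → mu i j' ≠ 0 → j = j')
    (hcol : ∀ i i' j, mu i j ≠ 0 → mu i' j ≠ 0 → i = i') :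
    ∀ g ∈ patternGroup F (fun i j : Fin n => i < j),
      Ind (patternGroup F (fun i j : Fin n => i < j))
          (patternGroup F (fun i j : Fin n => i < j ∧ (j : ℕ) + 1 ≤ m))
          (superchar (fun i j : Fin n => i < j ∧ (j : ℕ) + 1 ≤ m) θ (toMat F n mu)) g =
        charOfComb (fun i j : Fin n => i < j) θ (lstarIter mu m n) g := by
  have hfull : (fun i j : Fin n => i < j) = cornerOrder n n := by
    funext i j
    exact propext ⟨fun h => ⟨h, j.2⟩, fun h => h.1⟩
  rw [hfull]
  intro g hg
  obtain ⟨d, rfl⟩ := Nat.exists_eq_add_of_le hmn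
  obtain ⟨hs, hv⟩ :=
    Ind_superchar_eq_combVal hθadd hθne hθnt (mu := mu) ⟨hsupp, hrow, hcol⟩ d le_rfl
  rw [lstarIter, Nat.add_sub_cancel_left, charOfComb_eq_combVal hθadd hθne hθnt hs hg]
  exact hv g hg
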